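/- arXiv:1005.0812 — 3 statements merged into one kernel-verified Lean document; each statement's English description precedes it below -/
import Mathlib

section
/- Let (X,Y) be a centered bivariate Gaussian random vector with Var(X) > 0, Var(Y) > 0 and correlation strictly less than 1. Then P(X > b, Y > b) = o( max(P(X > b), P(Y > b)) ) as b → ∞, i.e. P(X > b, Y > b) / max(P(X > b), P(Y > b)) → 0 as b → ∞. -/
open MeasureTheory ProbabilityTheory Filter

namespace ProbabilityTheory

open Real Set
open scoped NNReal

lemma gaussianReal_real_Ioi_le {v w : ℝ≥0} (hw : w ≠ 0) (hvw : v ≤ w) {b : ℝ} (hb : 0 ≤ b) :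
    (gaussianReal 0 v).real (Ioi b) ≤ exp (-b ^ 2 / (2 * w)) := by
  have hw' : (0 : ℝ) < w := by exact_mod_cast pos_iff_ne_zero.mpr hw
  have hvw' : (v : ℝ) ≤ w := by exact_mod_cast hvw
  calc (gaussianReal 0 v).real (Ioi b)
      ≤ (gaussianReal 0 v).real {x | b ≤ id x} := measureReal_mono fun x (hx : b < x) => hx.le
    _ ≤ exp (-(b / w) * b) * mgf id (gaussianReal 0 v) (b / w) :=
        measure_ge_le_exp_mul_mgf b (by positivity) (integrable_exp_mul_gaussianReal _)
    _ = exp (-(b / w) * b + v * (b / w) ^ 2 / 2) := by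
        rw [mgf_id_gaussianReal, ← exp_add, zero_mul, zero_add]
    _ ≤ exp (-(b / w) * b + w * (b / w) ^ 2 / 2) := by gcongr
    _ = exp (-b ^ 2 / (2 * w)) := by congr 1; field_simp; ring

lemma le_gaussianReal_real_Ioi {v : ℝ≥0} (hv : v ≠ 0) {b : ℝ} (hb : 0 ≤ b) :
    (√(2 * π * v))⁻¹ * exp (-(b + 1) ^ 2 / (2 * v)) ≤ (gaussianReal 0 v).real (Ioi b) := by
  have hint := integrable_gaussianPDFReal 0 v
  calc (√(2 * π * v))⁻¹ * exp (-(b + 1) ^ 2 / (2 * v))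
      = ∫ _ in Ioc b (b + 1), (√(2 * π * v))⁻¹ * exp (-(b + 1) ^ 2 / (2 * v)) := by simp
    _ ≤ ∫ x in Ioc b (b + 1), gaussianPDFReal 0 v x := by
        refine setIntegral_mono_on (integrableOn_const measure_Ioc_lt_top.ne)
          hint.integrableOn measurableSet_Ioc fun x hx => ?_
        have : 0 ≤ x := hb.trans hx.1.le
        rw [gaussianPDFReal, sub_zero]
        gcongr
        exact hx.2
    _ ≤ ∫ x in Ioi b, gaussianPDFReal 0 v x :=
        setIntegral_mono_set hint.integrableOn
          (ae_of_all _ fun x => gaussianPDFReal_nonneg 0 v x) Ioc_subset_Ioi_self.eventuallyLE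
    _ = (gaussianReal 0 v).real (Ioi b) := by
        rw [measureReal_def, gaussianReal_apply_eq_integral 0 hv,
          ENNReal.toReal_ofReal (integral_nonneg fun x => gaussianPDFReal_nonneg 0 v x)]

lemma tendsto_gaussianReal_Ioi_div_gaussianReal_Ioi {v w : ℝ≥0} (hvw : v < w) :
    Tendsto (fun b => (gaussianReal 0 v).real (Ioi b) / (gaussianReal 0 w).real (Ioi b))
      atTop (nhds 0) := by
  obtain ⟨u, hvu, huw⟩ := exists_between hvw
  have hu : (0 : ℝ) < u := by exact_mod_cast (zero_le.trans_lt hvu)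
  have huw' : (u : ℝ) < w := by exact_mod_cast huw
  have hw : (0 : ℝ) < w := hu.trans huw'
  have hlin : Tendsto (fun b : ℝ => ((2 * (u : ℝ))⁻¹ - (2 * (w : ℝ))⁻¹) * b + -(w : ℝ)⁻¹)
      atTop atTop := by
    refine tendsto_atTop_add_const_right _ _ (tendsto_id.const_mul_atTop (sub_pos.mpr ?_))
    gcongr
  have hbot : Tendsto (fun b : ℝ => (b + 1) ^ 2 / (2 * (w : ℝ)) - b ^ 2 / (2 * u))
      atTop atBot := by
    have h := tendsto_atBot_add_const_right _ (2 * (w : ℝ))⁻¹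
      (tendsto_neg_atTop_atBot.comp (hlin.atTop_mul_atTop₀ tendsto_id))
    refine h.congr fun b => ?_
    simp only [Function.comp_apply, id_eq]
    field_simp
    ring
  have hlim := (tendsto_exp_atBot.comp hbot).const_mul (√(2 * π * w))
  rw [mul_zero] at hlim
  refine squeeze_zero' (Eventually.of_forall fun b => by positivity) ?_ hlim
  filter_upwards [eventually_ge_atTop 0] with b hb
  have hlow := le_gaussianReal_real_Ioi (v := w) (by exact_mod_cast hw.ne') hb
  calc (gaussianReal 0 v).real (Ioi b) / (gaussianReal 0 w).real (Ioi b)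
      ≤ exp (-b ^ 2 / (2 * u)) / ((√(2 * π * w))⁻¹ * exp (-(b + 1) ^ 2 / (2 * w))) := by
        gcongr
        exact gaussianReal_real_Ioi_le (by exact_mod_cast hu.ne') hvu.le hb
    _ = √(2 * π * w) * exp ((b + 1) ^ 2 / (2 * w) - b ^ 2 / (2 * u)) := by
        rw [div_mul_eq_div_div, div_inv_eq_mul, mul_comm, mul_div_assoc, ← exp_sub]
        congr 2
        ring

variable {Ω : Type*} {mΩ : MeasurableSpace Ω} {P : Measure Ω} {X : Ω → ℝ} {v : ℝ≥0}

lemma memLp_two_of_map_eq_gaussianReal (hX : Measurable X) (h : P.map X = gaussianReal 0 v) :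
    MemLp X 2 P := by
  have := memLp_id_gaussianReal' (μ := 0) (v := v) 2 (by simp)
  rw [← h] at this
  exact this.comp_of_map hX.aemeasurable

lemma integral_sq_of_map_eq_gaussianReal (hX : Measurable X) (h : P.map X = gaussianReal 0 v) :
    ∫ ω, X ω ^ 2 ∂P = v := by
  rw [← variance_id_gaussianReal (μ := 0) (v := v), variance_of_integral_eq_zero
    aemeasurable_id integral_id_gaussianReal, ← h]
  exact (integral_map (f := fun x => x ^ 2) hX.aemeasurable (by fun_prop)).symm

lemma measure_gt_toReal_of_map_eq {μ : Measure ℝ} (hX : Measurable X) (h : P.map X = μ) (b : ℝ) :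
    (P {ω | X ω > b}).toReal = μ.real (Ioi b) := by
  rw [← h, map_measureReal_apply hX measurableSet_Ioi]
  rfl

end ProbabilityTheory

/-- Let `(X, Y)` be a centered bivariate Gaussian random vector with
`Var X > 0`, `Var Y > 0` and correlation strictly less than `1`.  Then
`P(X > b, Y > b) = o(max(P(X > b), P(Y > b)))` as `b → ∞`. -/
theorem joint_tail_negligible_of_bivariate_gaussian
    {Ω : Type} [MeasureSpace Ω] [IsProbabilityMeasure (ℙ : Measure Ω)]
    (X Y : Ω → ℝ) (hX : Measurable X) (hY : Measurable Y)
    -- (X, Y) is a centered bivariate Gaussian vector: every linear combination is a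
    -- centered real Gaussian random variable
    (hGauss : ∀ a c : ℝ, ∃ v : NNReal,
      Measure.map (fun ω => a * X ω + c * Y ω) (ℙ : Measure Ω) = gaussianReal 0 v)
    -- positive variances
    (hVarX : 0 < ∫ ω, (X ω) ^ 2) (hVarY : 0 < ∫ ω, (Y ω) ^ 2)
    -- correlation strictly less than one
    (hcorr : (∫ ω, X ω * Y ω) /
        (Real.sqrt (∫ ω, (X ω) ^ 2) * Real.sqrt (∫ ω, (Y ω) ^ 2)) < 1) :
    Tendsto
      (fun b : ℝ => (ℙ {ω | X ω > b ∧ Y ω > b}).toReal /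
        max (ℙ {ω | X ω > b}).toReal (ℙ {ω | Y ω > b}).toReal)
      atTop (nhds 0) := by
  obtain ⟨vX, hvX⟩ := hGauss 1 0
  obtain ⟨vY, hvY⟩ := hGauss 0 1
  obtain ⟨v, hv⟩ := hGauss (1 / 2) (1 / 2)
  simp only [one_mul, zero_mul, add_zero, zero_add] at hvX hvY
  have hZ : Measurable fun ω => 1 / 2 * X ω + 1 / 2 * Y ω := by fun_prop
  have hX2 := memLp_two_of_map_eq_gaussianReal hX hvX
  have hY2 := memLp_two_of_map_eq_gaussianReal hY hvY
  have hv_eq : (v : ℝ) = (vX + vY + 2 * ∫ ω, X ω * Y ω) / 4 := by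
    rw [← integral_sq_of_map_eq_gaussianReal hZ hv, ← integral_sq_of_map_eq_gaussianReal hX hvX,
      ← integral_sq_of_map_eq_gaussianReal hY hvY, ← integral_const_mul,
      ← integral_add hX2.integrable_sq hY2.integrable_sq,
      ← integral_add (f := fun ω => X ω ^ 2 + Y ω ^ 2) (g := fun ω => 2 * (X ω * Y ω))
        (hX2.integrable_sq.add hY2.integrable_sq) ((hX2.integrable_mul hY2).const_mul 2),
      ← integral_div]
    congr with ω
    ring
  rw [integral_sq_of_map_eq_gaussianReal hX hvX] at hVarX hcorr
  rw [integral_sq_of_map_eq_gaussianReal hY hvY] at hVarY hcorr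
  have hcov : ∫ ω, X ω * Y ω < √vX * √vY := by
    rwa [div_lt_one (by positivity)] at hcorr
  have hv_lt : v < max vX vY := by
    rw [← NNReal.coe_lt_coe, NNReal.coe_max]
    have hsqX := Real.sq_sqrt hVarX.le
    have hsqY := Real.sq_sqrt hVarY.le
    have := sq_nonneg (√(vX : ℝ) - √vY)
    have := le_max_left (vX : ℝ) vY
    have := le_max_right (vX : ℝ) vY
    nlinarith
  have hjoint (b : ℝ) :
      (ℙ {ω | X ω > b ∧ Y ω > b}).toReal ≤ (gaussianReal 0 v).real (Set.Ioi b) := by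
    rw [← measure_gt_toReal_of_map_eq hZ hv]
    refine measureReal_mono fun ω hω => ?_
    simp only [Set.mem_ofPred_eq] at hω ⊢
    linarith
  have hmax (b : ℝ) : (gaussianReal 0 (max vX vY)).real (Set.Ioi b) ≤
      max (ℙ {ω | X ω > b}).toReal (ℙ {ω | Y ω > b}).toReal := by
    rw [measure_gt_toReal_of_map_eq hX hvX, measure_gt_toReal_of_map_eq hY hvY]
    rcases max_cases vX vY with h | h <;> simp [h.1]
  refine squeeze_zero' (Eventually.of_forall fun b => by positivity) ?_
    (tendsto_gaussianReal_Ioi_div_gaussianReal_Ioi hv_lt)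
  filter_upwards [eventually_ge_atTop 0] with b hb
  have hpos : 0 < (gaussianReal 0 (max vX vY)).real (Set.Ioi b) := by
    refine lt_of_lt_of_le ?_ (le_gaussianReal_real_Ioi (zero_le.trans_lt hv_lt).ne' hb)
    have : (0 : ℝ) < (max vX vY : NNReal) := by exact_mod_cast zero_le.trans_lt hv_lt
    positivity
  gcongr
  exacts [hjoint b, hmax b]
end

section
/- Assume Conditions A1–A4. Let U₁,…,U_M be i.i.d. uniform random variables on T independent of f, and define w(b) = P(max_{t∈T} f(t) > b) and w_M(γ) = P(max_{1≤i≤M} f(U_i) > γ). Then for every M ≥ 1, a > 0 and b > 0, |w(b) − w_M(γ_{a,b})| ≤ E[ exp(−M m(A_{γ_{a,b}})/m(T)) ; A_b ∩ T ≠ ∅ ] + P( max_{t∈T} f(t) > γ_{a,b}, max_{t∈T} f(t) ≤ b ). -/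
open MeasureTheory ProbabilityTheory Filter
open scoped Classical

noncomputable section

/-- The ℓ¹ norm `|x| = ∑ⱼ |xⱼ|` on `ℝ^d`. -/
def nrm {d : ℕ} (x : Fin d → ℝ) : ℝ := ∑ j, |x j|

/-- If `S` has empty sections outside `E ∪ F`, the probability of `E` differs from that of one of
`M` independent samples hitting the section of `S` by at most the exponential miss probability
on `E` plus the probability of `F`. -/
theorem abs_measure_sub_prod_pi_exists_le {Ω X : Type*} [MeasurableSpace Ω] [MeasurableSpace X]
    (P : Measure Ω) [IsProbabilityMeasure P] (ν : Measure X) [IsProbabilityMeasure ν]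
    {S : Set (Ω × X)} (hS : MeasurableSet S) {E F : Set Ω} (hE : MeasurableSet E)
    (hF : MeasurableSet F) (hEF : ∀ ω, ω ∉ E → ω ∉ F → Prod.mk ω ⁻¹' S = ∅) (M : ℕ) :
    |P.real E - (P.prod (Measure.pi fun _ : Fin M => ν)).real {p | ∃ i, (p.1, p.2 i) ∈ S}|
      ≤ (∫ ω in E, Real.exp (-(M : ℝ) * ν.real (Prod.mk ω ⁻¹' S)) ∂P) + P.real F := by
  set B : Set (Ω × (Fin M → X)) := {p | ∃ i, (p.1, p.2 i) ∈ S}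
  set q : Ω → ℝ := fun ω => (1 - ν.real (Prod.mk ω ⁻¹' S)) ^ M
  have hB : MeasurableSet B := by
    have : B = ⋃ i, (fun p : Ω × (Fin M → X) => (p.1, p.2 i)) ⁻¹' S := by
      ext p; simp [B]
    rw [this]
    exact MeasurableSet.iUnion fun i => (by fun_prop : Measurable _) hS
  have hνm : Measurable fun ω => ν.real (Prod.mk ω ⁻¹' S) :=
    (measurable_measure_prodMk_left hS).ennreal_toReal
  have hsec : ∀ ω, (Measure.pi fun _ : Fin M => ν).real (Prod.mk ω ⁻¹' B) = 1 - q ω := by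
    intro ω
    have h1 : (Prod.mk ω ⁻¹' B)ᶜ = Set.univ.pi fun _ : Fin M => (Prod.mk ω ⁻¹' S)ᶜ := by
      ext x; simp [B]
    have h2 : (Measure.pi fun _ : Fin M => ν).real (Prod.mk ω ⁻¹' B)ᶜ = q ω := by
      rw [h1, measureReal_def, Measure.pi_pi, Finset.prod_const, ENNReal.toReal_pow,
        ← measureReal_def, probReal_compl_eq_one_sub (measurable_prodMk_left hS)]
      simp [q]
    rw [probReal_compl_eq_one_sub (measurable_prodMk_left hB)] at h2
    linarith
  have hq : Measurable q := by fun_prop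
  have hν0 : ∀ ω, 0 ≤ 1 - ν.real (Prod.mk ω ⁻¹' S) := fun ω => by
    linarith [measureReal_le_one (μ := ν) (s := Prod.mk ω ⁻¹' S)]
  have hq0 : ∀ ω, 0 ≤ q ω := fun ω => pow_nonneg (hν0 ω) _
  have hq1 : ∀ ω, q ω ≤ 1 := fun ω =>
    pow_le_one₀ (hν0 ω) (by linarith [measureReal_nonneg (μ := ν) (s := Prod.mk ω ⁻¹' S)])
  have hqexp : ∀ ω, q ω ≤ Real.exp (-(M : ℝ) * ν.real (Prod.mk ω ⁻¹' S)) := fun ω => by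
    have h := pow_le_pow_left₀ (hν0 ω) (Real.one_sub_le_exp_neg (ν.real (Prod.mk ω ⁻¹' S))) M
    rwa [← Real.exp_nat_mul, mul_neg, ← neg_mul] at h
  have hqint : Integrable q P := Integrable.of_bound hq.aestronglyMeasurable 1
    (ae_of_all _ fun ω => by rw [Real.norm_eq_abs, abs_of_nonneg (hq0 ω)]; exact hq1 ω)
  have hexpint : Integrable (fun ω => Real.exp (-(M : ℝ) * ν.real (Prod.mk ω ⁻¹' S))) P := by
    refine Integrable.of_bound (hνm.const_mul _).exp.aestronglyMeasurable 1 (ae_of_all _ fun ω => ?_)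
    rw [Real.norm_eq_abs, Real.abs_exp, Real.exp_le_one_iff]
    have := measureReal_nonneg (μ := ν) (s := Prod.mk ω ⁻¹' S)
    have := mul_nonneg (Nat.cast_nonneg (α := ℝ) M) this
    linarith
  have hPB : (P.prod (Measure.pi fun _ : Fin M => ν)).real B = ∫ ω, (1 - q ω) ∂P := by
    rw [measureReal_def, Measure.prod_apply hB, ← integral_toReal
      (measurable_measure_prodMk_left hB).aemeasurable (ae_of_all _ fun ω => measure_lt_top _ _)]
    exact integral_congr_ae (ae_of_all _ hsec)
  have hqint' : Integrable (fun ω => 1 - q ω) P := (integrable_const 1).sub hqint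
  have hEint : Integrable (E.indicator (1 : Ω → ℝ)) P := (integrable_const 1).indicator hE
  have hFint : Integrable (F.indicator (1 : Ω → ℝ)) P := (integrable_const 1).indicator hF
  rw [hPB, ← integral_indicator_one hE, ← integral_indicator_one hF, ← integral_indicator hE,
    ← integral_sub hEint hqint',
    ← integral_add (hexpint.indicator hE) hFint]
  refine abs_integral_le_integral_abs.trans
    (integral_mono (hEint.sub hqint').abs
      ((hexpint.indicator hE).add hFint) fun ω => ?_)
  have := hq0 ω
  have := hq1 ω
  have := hqexp ω
  by_cases h1 : ω ∈ E <;> by_cases h2 : ω ∈ F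
  · simp only [h1, h2, Set.indicator_of_mem, Pi.one_apply]
    rw [abs_of_nonneg] <;> linarith
  · simp only [h1, h2, Set.indicator_of_mem, Pi.one_apply,
      not_false_eq_true, Set.indicator_of_notMem]
    rw [abs_of_nonneg] <;> linarith
  · simp only [h1, h2, Set.indicator_of_mem, Pi.one_apply,
      not_false_eq_true, Set.indicator_of_notMem]
    rw [abs_of_nonpos] <;> linarith
  · have hq' : q ω = 1 := by simp [q, hEF ω h1 h2]
    simp [h1, h2, hq']

/-- The event that a continuous random field exceeds a level somewhere is measurable. -/
theorem measurableSet_exists_lt_of_continuous {Ω X : Type*} [MeasurableSpace Ω]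
    [TopologicalSpace X] [TopologicalSpace.SeparableSpace X] {g : X → Ω → ℝ}
    (hg : ∀ t, Measurable (g t)) (hc : ∀ ω, Continuous fun t => g t ω) (c : ℝ) :
    MeasurableSet {ω | ∃ t, c < g t ω} := by
  obtain ⟨D, hD, hdense⟩ := TopologicalSpace.exists_countable_dense X
  have : {ω | ∃ t, c < g t ω} = ⋃ t ∈ D, {ω | c < g t ω} := by
    ext ω
    simp only [Set.mem_ofPred_eq, Set.mem_iUnion, exists_prop]
    refine ⟨fun ⟨t, ht⟩ => ?_, fun ⟨t, _, ht⟩ => ⟨t, ht⟩⟩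
    obtain ⟨s, hs, hsD⟩ := hdense.inter_open_nonempty _ (isOpen_lt continuous_const (hc ω)) ⟨t, ht⟩
    exact ⟨s, hsD, hs⟩
  rw [this]
  exact MeasurableSet.biUnion hD fun t _ => measurableSet_lt measurable_const (hg t)

/-- bias bound, Proposition `PropBias`.  Under Conditions A1–A4, with
`U₁, …, U_M` i.i.d. uniform on `T` independent of `f`, `w(b) = P(max_{t∈T} f(t) > b)` and
`w_M(γ) = P(max_i f(U_i) > γ)` (realized on the product space `Ω × T^M`), one has
`|w(b) − w_M(γ_{a,b})| ≤ E[exp(−M m(A_{γ_{a,b}})/m(T)); A_b ∩ T ≠ ∅]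
  + P(max_{t∈T} f(t) > γ_{a,b}, max_{t∈T} f(t) ≤ b)`, where `A_u = {t ∈ T : f(t) > u}`
and `γ_{a,b} = b − a/b`. -/
theorem discretization_bias_bound
    {Ω : Type} [MeasureSpace Ω] [IsProbabilityMeasure (ℙ : Measure Ω)]
    {d : ℕ} (hd : 0 < d)
    (T : Set (Fin d → ℝ)) (hTcompact : IsCompact T) (h0T : (0 : Fin d → ℝ) ∈ T)
    (f : (Fin d → ℝ) → Ω → ℝ) (hfmeas : ∀ t, Measurable (f t))
    -- `f` is a Gaussian random field on `T`
    (hGauss : ∀ (n : ℕ) (t : Fin n → (Fin d → ℝ)), (∀ i, t i ∈ T) →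
      ∀ c : Fin n → ℝ, ∃ (m : ℝ) (v : NNReal),
        Measure.map (fun ω => ∑ i, c i * f (t i) ω) (ℙ : Measure Ω) = gaussianReal m v)
    -- mean, covariance and standard deviation functions
    (μ : (Fin d → ℝ) → ℝ) (C : (Fin d → ℝ) → (Fin d → ℝ) → ℝ) (σ : (Fin d → ℝ) → ℝ)
    (hμ : ∀ t ∈ T, μ t = ∫ ω, f t ω)
    (hC : ∀ s ∈ T, ∀ t ∈ T, C s t = ∫ ω, (f s ω - μ s) * (f t ω - μ t))
    (hσ : ∀ t ∈ T, σ t = Real.sqrt (C t t)) (hσpos : ∀ t ∈ T, 0 < σ t)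
    -- Condition A1: almost sure continuity on T
    (hA1 : ∀ᵐ ω ∂(ℙ : Measure Ω), ContinuousOn (fun t => f t ω) T)
    -- Conditions A2 and A3, with Hölder exponent `β` and constant `κH`
    (β κH δ : ℝ) (hβ : 0 < β) (hκH : 0 < κH) (hδ : 0 < δ)
    (hA2 : ∀ s ∈ T, ∀ t ∈ T, nrm (s - t) < δ →
      |σ t - σ s| + |μ t - μ s| ≤ κH * nrm (s - t) ^ β)
    (hA3 : ∀ s ∈ T, ∀ s' ∈ T, ∀ t ∈ T, ∀ t' ∈ T,
      nrm (t - t') < δ → nrm (s - s') < δ →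
      |C t s / (σ t * σ s) - C t' s' / (σ t' * σ s')| ≤
        κH * (nrm (t - t') ^ β + nrm (s - s') ^ β))
    -- Condition A4
    (κ₀ ε₁ : ℝ) (hκ₀ : 0 < κ₀) (hε₁ : 0 < ε₁)
    (hA4 : ∀ t ∈ T, ∀ ε : ℝ, 0 < ε → ε < ε₁ →
      κ₀ * ε ^ d * (volume {x : Fin d → ℝ | nrm x ≤ 1}).toReal ≤
        (volume ({s | nrm (s - t) ≤ ε} ∩ T)).toReal)
    -- `ν` is the uniform distribution on `T`
    (ν : Measure (Fin d → ℝ)) [IsProbabilityMeasure ν]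
    (hν : ν = (volume T)⁻¹ • volume.restrict T)
    (M : ℕ) (hM : 1 ≤ M) (a b : ℝ) (ha : 0 < a) (hb : 0 < b) :
    |(ℙ {ω | ∃ t ∈ T, f t ω > b}).toReal -
        (((ℙ : Measure Ω).prod (Measure.pi fun _ : Fin M => ν))
          {p | ∃ i, f (p.2 i) p.1 > b - a / b}).toReal|
      ≤ (∫ ω in {ω | ∃ t ∈ T, f t ω > b},
            Real.exp (-(M : ℝ) *
              (volume {t | t ∈ T ∧ f t ω > b - a / b}).toReal / (volume T).toReal))
        + (ℙ {ω | (∃ t ∈ T, f t ω > b - a / b) ∧ ∀ t ∈ T, f t ω ≤ b}).toReal := by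
  obtain ⟨G, hGsub, hGm, hG0⟩ :
      ∃ G : Set Ω, (∀ ω ∈ G, ContinuousOn (fun t => f t ω) T) ∧ MeasurableSet G ∧
        ∀ᵐ ω ∂(ℙ : Measure Ω), ω ∈ G := by
    obtain ⟨N, hN, hNm, hN0⟩ := exists_measurable_superset_of_null (ae_iff.1 hA1)
    exact ⟨Nᶜ, fun ω h => not_not.1 fun hω => h (hN hω), hNm.compl,
      measure_eq_zero_iff_ae_notMem.1 hN0⟩
  have hTm : MeasurableSet T := hTcompact.measurableSet
  set γ := b - a / b
  have hνapply : ∀ A : Set (Fin d → ℝ), A ⊆ T →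
      ν.real A = (volume A).toReal / (volume T).toReal := by
    intro A hA
    have : (volume.restrict T) A = volume A := by
      rw [Measure.restrict_apply' hTm, Set.inter_eq_left.2 hA]
    rw [measureReal_def, hν, Measure.smul_apply, this, smul_eq_mul, ENNReal.toReal_mul,
      ENNReal.toReal_inv, mul_comm, div_eq_mul_inv]
  have hνT : ∀ᵐ t ∂ν, t ∈ T := by
    rw [hν]
    exact Measure.ae_smul_measure (ae_restrict_mem hTm) _
  -- a version of the field on `T` that is continuous everywhere
  set g : T → Ω → ℝ := fun t => G.indicator (f t)
  have hgm : ∀ t, Measurable (g t) := fun t => (hfmeas t).indicator hGm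
  have hgf : ∀ ω ∈ G, ∀ t, g t ω = f t ω := fun ω h t => Set.indicator_of_mem h _
  have hgc : ∀ ω, Continuous fun t => g t ω := by
    intro ω
    by_cases h : ω ∈ G
    · simp only [hgf ω h]
      exact (hGsub ω h).domRestrict
    · simp only [g, Set.indicator_of_notMem h]
      exact continuous_const
  have hg : Measurable (Function.uncurry g) :=
    measurable_uncurry_of_continuous_of_measurable hgc hgm
  set S : Set (Ω × (Fin d → ℝ)) :=
    (fun p : Ω × T => (p.1, (p.2 : Fin d → ℝ))) '' {p | γ < g p.2 p.1}
  have hSm : MeasurableSet S :=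
    (MeasurableEmbedding.id.prodMap (MeasurableEmbedding.subtype_coe hTm)).measurableSet_image.2
      (measurableSet_lt measurable_const (hg.comp measurable_swap))
  have hSmem : ∀ ω ∈ G, ∀ t, (ω, t) ∈ S ↔ t ∈ T ∧ f t ω > γ := by
    intro ω h t
    constructor
    · rintro ⟨⟨ω', s⟩, hs, heq⟩
      obtain ⟨rfl, rfl⟩ := Prod.mk.inj heq
      exact ⟨s.2, by simpa [hgf _ h] using hs⟩
    · rintro ⟨ht, hlt⟩
      exact ⟨(ω, ⟨t, ht⟩), by simpa [hgf ω h] using hlt, rfl⟩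
  set E : Set Ω := {ω | ∃ t, b < g t ω}
  set E' : Set Ω := {ω | ∃ t, γ < g t ω}
  have hE : MeasurableSet E := measurableSet_exists_lt_of_continuous hgm hgc b
  have hE' : MeasurableSet E' := measurableSet_exists_lt_of_continuous hgm hgc γ
  have key := abs_measure_sub_prod_pi_exists_le (ℙ : Measure Ω) ν hSm hE (hE'.diff hE)
    (fun ω h1 h2 => by
      rw [Set.eq_empty_iff_forall_notMem]
      rintro t ⟨⟨ω', s⟩, hs, heq⟩
      obtain ⟨rfl, rfl⟩ := Prod.mk.inj heq
      exact h2 ⟨⟨s, hs⟩, h1⟩) M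
  have hEeq : {ω | ∃ t ∈ T, f t ω > b} =ᵐ[ℙ] E := by
    filter_upwards [hG0] with ω h
    apply propext
    change (∃ t ∈ T, f t ω > b) ↔ ∃ t, b < g t ω
    simp [hgf ω h]
  have hFeq : {ω | (∃ t ∈ T, f t ω > γ) ∧ ∀ t ∈ T, f t ω ≤ b} =ᵐ[ℙ] (E' \ E : Set Ω) := by
    filter_upwards [hG0] with ω h
    apply propext
    change ((∃ t ∈ T, f t ω > γ) ∧ ∀ t ∈ T, f t ω ≤ b) ↔
      (∃ t, γ < g t ω) ∧ ¬ ∃ t, b < g t ω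
    simp [hgf ω h]
  have hBeq : {p : Ω × (Fin M → Fin d → ℝ) | ∃ i, f (p.2 i) p.1 > γ}
      =ᵐ[(ℙ : Measure Ω).prod (Measure.pi fun _ : Fin M => ν)]
        {p | ∃ i, (p.1, p.2 i) ∈ S} := by
    have h1 : ∀ᵐ x ∂(Measure.pi fun _ : Fin M => ν), ∀ i, x i ∈ T :=
      ae_all_iff.2 fun i => Measure.tendsto_eval_ae_ae.eventually hνT
    filter_upwards [Measure.quasiMeasurePreserving_fst.ae hG0,
      Measure.quasiMeasurePreserving_snd.ae h1] with p hp hx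
    apply propext
    change (∃ i, f (p.2 i) p.1 > γ) ↔ ∃ i, (p.1, p.2 i) ∈ S
    simp [hSmem p.1 hp, hx]
  rw [measure_congr hEeq, measure_congr hFeq, measure_congr hBeq, setIntegral_congr_set hEeq]
  refine key.trans_eq ?_
  congr 1
  refine integral_congr_ae (ae_restrict_of_ae ?_)
  filter_upwards [hG0] with ω h
  have hsec : Prod.mk ω ⁻¹' S = {t | t ∈ T ∧ f t ω > γ} := Set.ext fun t => hSmem ω h t
  rw [hsec, hνapply _ (fun t ht => ht.1), mul_div_assoc]
end
end

section
/- Assume Conditions A1–A4 with Hölder exponent β. For any v > 0 there exist constants κ, λ₂ ∈ (0,∞), independent of a ∈ (0,1) and of b, such that whenever α > 0 satisfies α^{-1} ≥ κ^{d/β}(b/a)^{(2+v)·2d/β}, and M ≥ 1, E[ exp(−M m(A_{γ_{a,b}})/m(T)) ; 0 < m(A_{γ_{a,b}}) ≤ α, m(A_b) > 0 ] ≤ E[m(A_{γ_{a,b}})] · E[W²] · (m(T)/(λ₂^{2d/β} M)) · (b/a)^{4d/β}, where W ≥ 0 is a random variable with P(W > x) = exp(−x^{β/d}) for x ≥ 0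 (so E[W²] = Γ(1 + 2d/β)). -/
open MeasureTheory ProbabilityTheory Filter
open scoped Classical

noncomputable section

lemma lintegral_exp_sq_div_four_gaussianReal_lt_top :
    ∫⁻ z, ENNReal.ofReal (Real.exp (z ^ 2 / 4)) ∂(gaussianReal 0 1) < ⊤ := by
  rw [gaussianReal_of_var_ne_zero 0 one_ne_zero,
    lintegral_withDensity_eq_lintegral_mul _ (measurable_gaussianPDF 0 1) (by fun_prop)]
  have hint : Integrable (fun z : ℝ => (Real.sqrt (2 * Real.pi))⁻¹ * Real.exp (-(1 / 4) * z ^ 2)) :=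
    (integrable_exp_neg_mul_sq (by norm_num)).const_mul _
  refine lt_of_le_of_lt (le_of_eq ?_) hint.lintegral_lt_top
  refine lintegral_congr fun z => ?_
  rw [Pi.mul_apply, gaussianPDF_def, ← ENNReal.ofReal_mul (gaussianPDFReal_nonneg _ _ _),
    gaussianPDFReal_def]
  congr 1
  simp only [NNReal.coe_one, mul_one, sub_zero]
  rw [mul_assoc, ← Real.exp_add]
  congr 2
  ring

/-- `E exp(Z² / 4)` for a standard Gaussian `Z`. -/
def gaussianExpSqMoment : ENNReal :=
  ∫⁻ z, ENNReal.ofReal (Real.exp (z ^ 2 / 4)) ∂(gaussianReal 0 1)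

lemma gaussianReal_eq_map_standard (m : ℝ) (v : NNReal) :
    gaussianReal m v = (gaussianReal 0 1).map (fun z => Real.sqrt v * z + m) := by
  have h1 : (gaussianReal 0 1).map (fun z => Real.sqrt v * z) = gaussianReal 0 v := by
    rw [gaussianReal_map_const_mul]
    congr 1
    · simp
    · ext; simp
  have h2 : (fun z => Real.sqrt v * z + m) = (fun z => z + m) ∘ (fun z => Real.sqrt v * z) := rfl
  rw [h2, ← Measure.map_map (by fun_prop) (by fun_prop), h1, gaussianReal_map_add_const, zero_add]

lemma lintegral_exp_mul_sq_gaussianReal_le {m c : ℝ} {v : NNReal} (hc : 0 ≤ c)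
    (hv : c * v ≤ 1 / 8) (hm : c * m ^ 2 ≤ 1 / 8) :
    ∫⁻ x, ENNReal.ofReal (Real.exp (c * x ^ 2)) ∂(gaussianReal m v)
      ≤ ENNReal.ofReal (Real.exp (1 / 4)) * gaussianExpSqMoment := by
  rw [gaussianReal_eq_map_standard, lintegral_map (by fun_prop) (by fun_prop), gaussianExpSqMoment,
    ← lintegral_const_mul _ (by fun_prop)]
  refine lintegral_mono fun z => ?_
  rw [← ENNReal.ofReal_mul (Real.exp_pos _).le, ← Real.exp_add]
  refine ENNReal.ofReal_le_ofReal (Real.exp_le_exp.mpr ?_)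
  have hs : Real.sqrt v ^ 2 = v := Real.sq_sqrt v.2
  have h1 : (Real.sqrt v * z + m) ^ 2 ≤ 2 * (v * z ^ 2) + 2 * m ^ 2 := by
    nlinarith [sq_nonneg (Real.sqrt v * z - m)]
  nlinarith [mul_le_mul_of_nonneg_left h1 hc, mul_le_mul_of_nonneg_right hv (sq_nonneg z)]

lemma le_gaussianReal_Ioi {m u y : ℝ} {v : NNReal} (hy : 0 ≤ y)
    (h : u - m ≤ Real.sqrt v * y) (hv : v ≠ 0) :
    ENNReal.ofReal ((Real.sqrt (2 * Real.pi))⁻¹ * Real.exp (-((y + 1) ^ 2 / 2)))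
      ≤ gaussianReal m v (Set.Ioi u) := by
  have hsv : 0 < Real.sqrt v := Real.sqrt_pos.mpr (by positivity)
  rw [gaussianReal_eq_map_standard, Measure.map_apply (by fun_prop) measurableSet_Ioi]
  have hsub : Set.Ioc y (y + 1) ⊆ (fun z => Real.sqrt v * z + m) ⁻¹' Set.Ioi u := by
    intro z hz
    have := mul_lt_mul_of_pos_left hz.1 hsv
    simp only [Set.mem_preimage, Set.mem_Ioi]
    linarith
  refine le_trans ?_ (measure_mono hsub)
  rw [gaussianReal_apply 0 one_ne_zero]
  calc ENNReal.ofReal ((Real.sqrt (2 * Real.pi))⁻¹ * Real.exp (-((y + 1) ^ 2 / 2)))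
      = ∫⁻ _ in Set.Ioc y (y + 1),
          ENNReal.ofReal ((Real.sqrt (2 * Real.pi))⁻¹ * Real.exp (-((y + 1) ^ 2 / 2))) := by
        rw [lintegral_const]; simp
    _ ≤ _ := by
        refine setLIntegral_mono (measurable_gaussianPDF 0 1) fun z hz => ?_
        rw [gaussianPDF_def, gaussianPDFReal_def]
        refine ENNReal.ofReal_le_ofReal ?_
        simp only [NNReal.coe_one, mul_one, sub_zero]
        gcongr
        rw [neg_div]
        have := hz.1
        have := hz.2
        have : z ^ 2 ≤ (y + 1) ^ 2 := by gcongr; linarith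
        linarith

lemma nrm_nonneg {d : ℕ} (x : Fin d → ℝ) : 0 ≤ nrm x := Finset.sum_nonneg fun _ _ => abs_nonneg _

lemma nrm_add_le {d : ℕ} (x y : Fin d → ℝ) : nrm (x + y) ≤ nrm x + nrm y := by
  unfold nrm
  rw [← Finset.sum_add_distrib]
  exact Finset.sum_le_sum fun j _ => abs_add_le _ _

lemma nrm_sub_comm {d : ℕ} (x y : Fin d → ℝ) : nrm (x - y) = nrm (y - x) := by
  unfold nrm
  exact Finset.sum_congr rfl fun j _ => abs_sub_comm _ _

@[simp] lemma nrm_zero {d : ℕ} : nrm (0 : Fin d → ℝ) = 0 := by simp [nrm]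

@[fun_prop] lemma continuous_nrm {d : ℕ} : Continuous (nrm : (Fin d → ℝ) → ℝ) := by
  unfold nrm; fun_prop

lemma norm_le_nrm {d : ℕ} (x : Fin d → ℝ) : ‖x‖ ≤ nrm x :=
  (pi_norm_le_iff_of_nonneg (nrm_nonneg x)).mpr fun j =>
    Finset.single_le_sum (f := fun j => |x j|) (fun _ _ => abs_nonneg _) (Finset.mem_univ j)

lemma nrm_le_of_forall_abs_le {d : ℕ} {x : Fin d → ℝ} {r : ℝ} (h : ∀ j, |x j| ≤ r) :
    nrm x ≤ d * r := by
  have := Finset.sum_le_card_nsmul Finset.univ (fun j => |x j|) r fun j _ => h j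
  simpa [nrm] using this

lemma volume_nrm_le_one_toReal_pos (d : ℕ) :
    0 < (volume {x : Fin d → ℝ | nrm x ≤ 1}).toReal := by
  refine ENNReal.toReal_pos (ne_of_gt ?_) (ne_of_lt ?_)
  · have ho : IsOpen {x : Fin d → ℝ | nrm x < 1} := isOpen_lt continuous_nrm continuous_const
    exact (ho.measure_pos volume ⟨0, by simp⟩).trans_le
      (measure_mono fun x (hx : nrm x < 1) => hx.le)
  · refine lt_of_le_of_lt (measure_mono (t := Metric.closedBall 0 1) fun x hx => ?_)
      (isCompact_closedBall _ _).measure_lt_top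
    simpa using (norm_le_nrm x).trans hx

lemma continuousOn_of_nrm_holder {d : ℕ} {T : Set (Fin d → ℝ)} {g : (Fin d → ℝ) → ℝ} {δ K β : ℝ}
    (hδ : 0 < δ) (hβ : 0 < β)
    (h : ∀ s ∈ T, ∀ t ∈ T, nrm (s - t) < δ → |g t - g s| ≤ K * nrm (s - t) ^ β) :
    ContinuousOn g T := by
  intro s hs
  have hc : Continuous fun t => K * nrm (s - t) ^ β :=
    continuous_const.mul ((by fun_prop : Continuous fun t => nrm (s - t)).rpow_const
      fun _ => Or.inr hβ.le)
  have hlim : Tendsto (fun t => K * nrm (s - t) ^ β) (nhdsWithin s T) (nhds 0) := by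
    have := (hc.tendsto s).mono_left (nhdsWithin_le_nhds (s := T))
    simpa [Real.zero_rpow hβ.ne'] using this
  have hnear : ∀ᶠ t in nhdsWithin s T, nrm (s - t) < δ := by
    refine nhdsWithin_le_nhds ?_
    have hc' : Continuous fun t => nrm (s - t) := by fun_prop
    exact hc'.continuousAt.eventually_lt continuousAt_const (by simpa using hδ)
  refine tendsto_iff_dist_tendsto_zero.mpr
    (squeeze_zero' (Eventually.of_forall fun _ => dist_nonneg) ?_ hlim)
  filter_upwards [hnear, self_mem_nhdsWithin] with t ht htT
  exact h s hs t htT ht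

/-- A bounded set has nets at dyadic scales whose cardinalities grow at most geometrically. -/
lemma exists_dyadic_nets {d : ℕ} {T : Set (Fin d → ℝ)} (hT : Bornology.IsBounded T)
    (hne : T.Nonempty) :
    ∃ (B : ℕ) (F : ℕ → Finset (Fin d → ℝ)), (∀ m, ∀ s ∈ F m, s ∈ T) ∧
      (∀ m, (F m).card ≤ B * (2 ^ d) ^ m) ∧
      ∀ m, ∀ t ∈ T, ∃ s ∈ F m, nrm (t - s) ≤ d * (1 / 2 : ℝ) ^ m := by
  obtain ⟨t₀, ht₀⟩ := hne
  obtain ⟨R, hR⟩ := hT.exists_norm_le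
  obtain ⟨N, hN⟩ := exists_nat_ge R
  let box : ℕ → (Fin d → ℝ) → (Fin d → ℤ) := fun m t j => ⌊t j * 2 ^ m⌋
  let rep : ℕ → (Fin d → ℤ) → (Fin d → ℝ) := fun m z =>
    if h : ∃ t ∈ T, box m t = z then h.choose else t₀
  have hrepT : ∀ m z, rep m z ∈ T := by
    intro m z
    by_cases h : ∃ t ∈ T, box m t = z
    · simp only [rep, dif_pos h]; exact h.choose_spec.1
    · simp only [rep, dif_neg h]; exact ht₀
  have hrepbox : ∀ m, ∀ t ∈ T, box m (rep m (box m t)) = box m t := by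
    intro m t ht
    have h : ∃ t' ∈ T, box m t' = box m t := ⟨t, ht, rfl⟩
    simp only [rep, dif_pos h]; exact h.choose_spec.2
  let J : ℕ → Finset (Fin d → ℤ) := fun m =>
    Fintype.piFinset fun _ : Fin d => Finset.Icc (-(N * 2 ^ m : ℤ)) (N * 2 ^ m)
  refine ⟨(2 * N + 1) ^ d, fun m => (J m).image (rep m), ?_, ?_, ?_⟩
  · intro m s hs
    obtain ⟨z, -, rfl⟩ := Finset.mem_image.mp hs
    exact hrepT m z
  · intro m
    refine Finset.card_image_le.trans ?_
    simp only [J, Fintype.card_piFinset, Int.card_Icc, Finset.prod_const, Finset.card_univ,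
      Fintype.card_fin]
    rw [← pow_mul, mul_comm d m, pow_mul, ← mul_pow]
    refine Nat.pow_le_pow_left ?_ d
    have h1 : (N * 2 ^ m + 1 - -(N * 2 ^ m) : ℤ).toNat = 2 * N * 2 ^ m + 1 := by
      have : (N * 2 ^ m + 1 - -(N * 2 ^ m) : ℤ) = ((2 * N * 2 ^ m + 1 : ℕ) : ℤ) := by
        push_cast; ring
      rw [this, Int.toNat_natCast]
    rw [h1]
    have := Nat.one_le_two_pow (n := m)
    nlinarith
  · intro m t ht
    have h2 : (0 : ℝ) < 2 ^ m := by positivity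
    refine ⟨rep m (box m t), Finset.mem_image_of_mem _ ?_, nrm_le_of_forall_abs_le fun j => ?_⟩
    · simp only [J, Fintype.mem_piFinset, Finset.mem_Icc]
      intro j
      have hj : |t j| ≤ N := ((norm_le_pi_norm t j).trans (hR t ht)).trans hN
      obtain ⟨hl, hu⟩ := abs_le.mp hj
      constructor
      · refine Int.le_floor.mpr ?_
        push_cast
        nlinarith
      · have : t j * 2 ^ m ≤ ((N * 2 ^ m : ℤ) : ℝ) := by
          push_cast
          nlinarith
        exact Int.cast_le.mp ((Int.floor_le _).trans this)
    · have h3 := Int.abs_sub_lt_one_of_floor_eq_floor (congrFun (hrepbox m t ht) j)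
      rw [← sub_mul, abs_mul, abs_of_pos h2, abs_sub_comm] at h3
      rw [one_div, inv_pow, ← one_div, le_div_iff₀ h2]
      exact h3.le

/-- Geometric control of the increments of a continuous function along consecutive nets gives
geometric control of its modulus of continuity. -/
lemma abs_sub_le_of_net_increments {d : ℕ} {T : Set (Fin d → ℝ)} {F : ℕ → Finset (Fin d → ℝ)}
    (hFT : ∀ m, ∀ s ∈ F m, s ∈ T)
    (hF : ∀ m, ∀ t ∈ T, ∃ s ∈ F m, nrm (t - s) ≤ d * (1 / 2 : ℝ) ^ m)
    {g : (Fin d → ℝ) → ℝ} (hg : ContinuousOn g T) {x q : ℝ} (hx : 0 ≤ x) (hq0 : 0 < q)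
    (hq1 : q < 1) {n : ℕ}
    (hinc : ∀ m, n ≤ m → ∀ s ∈ F m, ∀ t ∈ F (m + 1),
      nrm (s - t) ≤ (2 * d + 1) * (1 / 2 : ℝ) ^ m → |g s - g t| ≤ x * q ^ m)
    {s t : Fin d → ℝ} (hs : s ∈ T) (ht : t ∈ T) (hst : nrm (s - t) ≤ (1 / 2 : ℝ) ^ n) :
    |g s - g t| ≤ (1 + 2 / (1 - q)) * x * q ^ n := by
  choose! π hπF hπ using hF
  have hd0 : (0 : ℝ) ≤ d := Nat.cast_nonneg d
  have hhalf : ∀ m, (1 / 2 : ℝ) ^ (m + 1) ≤ (1 / 2 : ℝ) ^ m := fun m =>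
    pow_le_pow_of_le_one (by norm_num) (by norm_num) (Nat.le_succ m)
  have hstep : ∀ m, n ≤ m → ∀ u ∈ T, ∀ w ∈ T, nrm (u - w) ≤ (1 / 2 : ℝ) ^ m →
      |g (π m u) - g (π (m + 1) w)| ≤ x * q ^ m := by
    intro m hm u hu w hw huw
    refine hinc m hm _ (hπF m u hu) _ (hπF (m + 1) w hw) ?_
    have e : π m u - π (m + 1) w = (π m u - u) + ((u - w) + (w - π (m + 1) w)) := by abel
    have h1 := nrm_add_le (π m u - u) ((u - w) + (w - π (m + 1) w))
    have h2 := nrm_add_le (u - w) (w - π (m + 1) w)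
    have h3 := hπ m u hu
    have h4 := hπ (m + 1) w hw
    rw [nrm_sub_comm] at h3
    rw [e]
    nlinarith [mul_le_mul_of_nonneg_left (hhalf m) hd0]
  have hlim : ∀ u ∈ T, ∀ k, Tendsto (fun j => g (π (k + j) u)) atTop (nhds (g u)) := by
    intro u hu k
    refine (hg u hu).tendsto.comp (tendsto_nhdsWithin_iff.mpr
      ⟨?_, Eventually.of_forall fun j => hFT _ _ (hπF _ u hu)⟩)
    rw [tendsto_iff_dist_tendsto_zero]
    have h0 : Tendsto (fun j : ℕ => (d : ℝ) * (1 / 2 : ℝ) ^ j) atTop (nhds 0) := by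
      simpa using (tendsto_pow_atTop_nhds_zero_of_lt_one (r := (1 / 2 : ℝ))
        (by norm_num) (by norm_num)).const_mul (d : ℝ)
    refine squeeze_zero (fun _ => dist_nonneg) (fun j => ?_) h0
    rw [dist_comm, dist_eq_norm]
    refine (norm_le_nrm _).trans ((hπ (k + j) u hu).trans (mul_le_mul_of_nonneg_left ?_ hd0))
    exact pow_le_pow_of_le_one (by norm_num) (by norm_num) (Nat.le_add_left j k)
  have hchain : ∀ u ∈ T, ∀ k, n ≤ k → |g (π k u) - g u| ≤ x * q ^ k / (1 - q) := by
    intro u hu k hk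
    refine dist_le_of_le_geometric_of_tendsto₀ q (x * q ^ k) hq1 (f := fun j => g (π (k + j) u))
      (fun j => ?_) (hlim u hu k)
    refine (hstep (k + j) (by omega) u hu u hu (by simp)).trans (le_of_eq ?_)
    rw [pow_add]; ring
  have h1 := hchain s hs n le_rfl
  have h2 := hstep n le_rfl s hs t ht hst
  have h3 := hchain t ht (n + 1) (by omega)
  have h4 : x * q ^ (n + 1) / (1 - q) ≤ x * q ^ n / (1 - q) :=
    div_le_div_of_nonneg_right (mul_le_mul_of_nonneg_left
      (pow_le_pow_of_le_one hq0.le hq1.le (Nat.le_succ n)) hx) (by linarith)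
  have e : (1 + 2 / (1 - q)) * x * q ^ n = x * q ^ n + 2 * (x * q ^ n / (1 - q)) := by ring
  rw [e]
  rw [abs_le] at *
  constructor <;> linarith [h1.1, h1.2, h2.1, h2.2, h3.1, h3.2]

lemma pow_mul_exp_le {k : ℕ} {η y a : ℝ} (hη : 0 < η) (hy : 0 ≤ y) (ha : 0 ≤ a) (ha1 : a ≤ 1) :
    (y * a) ^ k * Real.exp (η * (y * a))
      ≤ a ^ k * (k.factorial / η ^ k) * Real.exp (2 * η * y) := by
  have h1 : (η * y) ^ k / k.factorial ≤ Real.exp (η * y) :=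
    Real.pow_div_factorial_le_exp _ (by positivity) k
  have hk : (0 : ℝ) < k.factorial := by positivity
  have h2 : y ^ k ≤ k.factorial / η ^ k * Real.exp (η * y) := by
    rw [div_le_iff₀ hk, mul_pow] at h1
    rw [div_mul_eq_mul_div, le_div_iff₀ (by positivity)]
    linarith
  have h3 : Real.exp (η * (y * a)) ≤ Real.exp (η * y) :=
    Real.exp_le_exp.mpr (mul_le_mul_of_nonneg_left (mul_le_of_le_one_right hy ha1) hη.le)
  have h4 : Real.exp (2 * η * y) = Real.exp (η * y) * Real.exp (η * y) := by
    rw [← Real.exp_add]; ring_nf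
  rw [mul_pow, h4]
  calc y ^ k * a ^ k * Real.exp (η * (y * a))
      ≤ (k.factorial / η ^ k * Real.exp (η * y)) * a ^ k * Real.exp (η * y) := by gcongr
    _ = _ := by ring

/-- The increments of a Gaussian field whose increment second moments are Hölder of order `β`
are dominated, at every scale and simultaneously for all pairs of points, by an integrable
random variable through a Gaussian-type functional of the `θ`-Hölder quotients, `2 θ < β`. -/
lemma exists_integrable_oscillation_bound {Ω : Type*} [MeasurableSpace Ω] {P : Measure Ω} {d : ℕ}
    {T : Set (Fin d → ℝ)} (hT : Bornology.IsBounded T) (hne : T.Nonempty)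
    {f : (Fin d → ℝ) → Ω → ℝ} (hfm : ∀ t, Measurable (f t))
    (hcont : ∀ᵐ ω ∂P, ContinuousOn (fun t => f t ω) T)
    {β θ δ B : ℝ} (hβ : 0 < β) (hθ : 0 < θ) (hθβ : 2 * θ < β) (hδ : 0 < δ) (hB : 0 ≤ B)
    (hinc : ∀ s ∈ T, ∀ t ∈ T, nrm (s - t) < δ → ∃ (m : ℝ) (v : NNReal),
      P.map (fun ω => f s ω - f t ω) = gaussianReal m v ∧
        m ^ 2 ≤ B * nrm (s - t) ^ β ∧ (v : ℝ) ≤ B * nrm (s - t) ^ β) (p : ℝ) :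
    ∃ (n₀ k : ℕ) (η C : ℝ) (S : Ω → ENNReal), p ≤ k ∧ 0 < η ∧ 0 < C ∧ ∫⁻ ω, S ω ∂P ≠ ⊤ ∧
      ∀ᵐ ω ∂P, ∀ n, n₀ ≤ n → ∀ s ∈ T, ∀ t ∈ T, nrm (s - t) ≤ (1 / 2 : ℝ) ^ n → ∀ x : ℝ, 0 < x →
        C * x * ((1 / 2 : ℝ) ^ θ) ^ n < |f s ω - f t ω| →
          ENNReal.ofReal ((x ^ 2) ^ k * Real.exp (η * x ^ 2)) ≤ S ω := by
  obtain ⟨N, F, hFT, hFcard, hF⟩ := exists_dyadic_nets hT hne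
  set q : ℝ := (1 / 2 : ℝ) ^ θ with hq
  set r : ℝ := (1 / 2 : ℝ) ^ β with hr
  have hq0 : 0 < q := by positivity
  have hr0 : 0 < r := by positivity
  have hq1 : q < 1 := Real.rpow_lt_one (by norm_num) (by norm_num) hθ
  set ρ : ℝ := r / q ^ 2 with hρ
  have hρ0 : 0 < ρ := by positivity
  have hρ1 : ρ < 1 := by
    rw [hρ, div_lt_one (by positivity), hq, hr, ← Real.rpow_natCast, ← Real.rpow_mul (by norm_num)]
    exact Real.rpow_lt_rpow_of_exponent_gt (by norm_num) (by norm_num) (by push_cast; linarith)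
  set D : ℝ := 2 * d + 1 with hD
  have hD0 : 0 < D := by positivity
  obtain ⟨n₀, hn₀⟩ : ∃ n₀ : ℕ, (1 / 2 : ℝ) ^ n₀ < δ / D :=
    exists_pow_lt_of_lt_one (by positivity) (by norm_num)
  obtain ⟨k₁, hk₁⟩ : ∃ k : ℕ, ρ ^ k < 1 / (2 * 4 ^ d) :=
    exists_pow_lt_of_lt_one (by positivity) hρ1
  obtain ⟨k₂, hk₂⟩ := exists_nat_ge p
  set k := max k₁ k₂ with hk
  have hρk : ρ ^ k * 4 ^ d ≤ 1 / 2 := by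
    have h1 : ρ ^ k ≤ ρ ^ k₁ := pow_le_pow_of_le_one hρ0.le hρ1.le (le_max_left _ _)
    have h2 : ρ ^ k ≤ 1 / (2 * 4 ^ d) := h1.trans hk₁.le
    calc ρ ^ k * 4 ^ d ≤ 1 / (2 * 4 ^ d) * 4 ^ d := by gcongr
      _ = 1 / 2 := by field_simp
  set B' : ℝ := B * D ^ β + 1 with hB'
  have hB'0 : 0 < B' := by positivity
  set η : ℝ := 1 / (16 * B') with hη
  have hη0 : 0 < η := by positivity
  let Φ : ℝ → ℝ := fun y => y ^ k * Real.exp (η * y)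
  have hΦmono : ∀ y z, 0 ≤ y → y ≤ z → Φ y ≤ Φ z := by
    intro y z hy hyz
    have hz : 0 ≤ z := hy.trans hyz
    simp only [Φ]
    gcongr
  let term : (m : ℕ) → (Fin d → ℝ) → (Fin d → ℝ) → Ω → ENNReal := fun m s t ω =>
    if n₀ ≤ m ∧ nrm (s - t) ≤ D * (1 / 2 : ℝ) ^ m then
      ENNReal.ofReal (Φ (((f s ω - f t ω) / q ^ m) ^ 2)) else 0
  have hterm_meas : ∀ m s t, Measurable (term m s t) := by
    intro m s t
    have h1 := hfm s
    have h2 := hfm t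
    by_cases h : n₀ ≤ m ∧ nrm (s - t) ≤ D * (1 / 2 : ℝ) ^ m
    · simp only [term, if_pos h, Φ]; fun_prop
    · simp only [term, if_neg h]; fun_prop
  set G : ENNReal := ENNReal.ofReal (Real.exp (1 / 4)) * gaussianExpSqMoment with hG
  have hGtop : G ≠ ⊤ := ENNReal.mul_ne_top ENNReal.ofReal_ne_top
    lintegral_exp_sq_div_four_gaussianReal_lt_top.ne
  set Q : ℝ := k.factorial / η ^ k with hQ
  have hQ0 : 0 ≤ Q := by positivity
  have hterm_int : ∀ m, ∀ s ∈ F m, ∀ t ∈ F (m + 1),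
      ∫⁻ ω, term m s t ω ∂P ≤ ENNReal.ofReal ((ρ ^ k) ^ m * Q) * G := by
    intro m s hs t ht
    by_cases h : n₀ ≤ m ∧ nrm (s - t) ≤ D * (1 / 2 : ℝ) ^ m
    swap
    · simp only [term, if_neg h, lintegral_zero, zero_le]
    have hδ' : nrm (s - t) < δ := by
      refine h.2.trans_lt ?_
      have := (pow_le_pow_of_le_one (by norm_num) (by norm_num) h.1).trans_lt hn₀
      calc D * (1 / 2 : ℝ) ^ m < D * (δ / D) := by gcongr
        _ = δ := by field_simp
    obtain ⟨a, v, hmap, ha, hv⟩ := hinc s (hFT _ _ hs) t (hFT _ _ ht) hδ'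
    have hbd : B * nrm (s - t) ^ β ≤ B' * r ^ m := by
      have h1 : nrm (s - t) ^ β ≤ (D * (1 / 2 : ℝ) ^ m) ^ β :=
        Real.rpow_le_rpow (nrm_nonneg _) h.2 hβ.le
      have h2 : (D * (1 / 2 : ℝ) ^ m) ^ β = D ^ β * r ^ m := by
        rw [Real.mul_rpow hD0.le (by positivity), hr, ← Real.rpow_natCast, ← Real.rpow_natCast,
          ← Real.rpow_mul (by norm_num), ← Real.rpow_mul (by norm_num), mul_comm (m : ℝ)]
      rw [h2] at h1
      have h3 := mul_le_mul_of_nonneg_left h1 hB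
      have : 0 < r ^ m := by positivity
      rw [hB']
      nlinarith
    have hrm : 0 < r ^ m := by positivity
    have hscale : 2 * η / r ^ m * (B' * r ^ m) = 1 / 8 := by
      rw [hη]; field_simp; norm_num
    have hc0 : 0 ≤ 2 * η / r ^ m := by positivity
    have hgauss := lintegral_exp_mul_sq_gaussianReal_le (m := a) (v := v) hc0
      (hscale ▸ mul_le_mul_of_nonneg_left (hv.trans hbd) hc0)
      (hscale ▸ mul_le_mul_of_nonneg_left (ha.trans hbd) hc0)
    have hmeas : Measurable fun ω => f s ω - f t ω := (hfm s).sub (hfm t)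
    rw [← hmap, lintegral_map (by fun_prop) hmeas] at hgauss
    refine le_trans ?_ (mul_le_mul_right hgauss _)
    rw [← lintegral_const_mul _ (by fun_prop)]
    refine lintegral_mono fun ω => ?_
    simp only [term, if_pos h]
    rw [← ENNReal.ofReal_mul (by positivity)]
    refine ENNReal.ofReal_le_ofReal ?_
    have e : ((f s ω - f t ω) / q ^ m) ^ 2 = (f s ω - f t ω) ^ 2 / r ^ m * ρ ^ m := by
      rw [hρ, div_pow r, div_pow, ← pow_mul, ← pow_mul, mul_comm m 2]
      field_simp
    have := pow_mul_exp_le (k := k) (y := (f s ω - f t ω) ^ 2 / r ^ m) (a := ρ ^ m) hη0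
      (by positivity) (by positivity) (pow_le_one₀ hρ0.le hρ1.le)
    simp only [Φ]
    rw [e]
    refine this.trans (le_of_eq ?_)
    rw [← pow_mul, ← pow_mul, mul_comm m k]
    congr 2
    ring
  have hscale_int : ∀ m, ∫⁻ ω, ∑ s ∈ F m, ∑ t ∈ F (m + 1), term m s t ω ∂P
      ≤ ENNReal.ofReal ((N : ℝ) ^ 2 * 2 ^ d * Q) * G * (2⁻¹ : ENNReal) ^ m := by
    intro m
    rw [lintegral_finsetSum _ fun s _ => Finset.measurable_sum _ fun t _ => hterm_meas m s t]
    have h1 : ∀ s ∈ F m, ∫⁻ ω, ∑ t ∈ F (m + 1), term m s t ω ∂P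
        ≤ (F (m + 1)).card * (ENNReal.ofReal ((ρ ^ k) ^ m * Q) * G) := by
      intro s hs
      rw [lintegral_finsetSum _ fun t _ => hterm_meas m s t, ← nsmul_eq_mul]
      exact Finset.sum_le_card_nsmul _ _ _ fun t ht => hterm_int m s hs t ht
    have h2 := Finset.sum_le_card_nsmul _ _ _ h1
    refine h2.trans ?_
    rw [nsmul_eq_mul, ← mul_assoc, ← mul_assoc, mul_right_comm _ G]
    refine mul_le_mul_left ?_ G
    have e1 : ((2⁻¹ : ENNReal)) ^ m = ENNReal.ofReal ((1 / 2 : ℝ) ^ m) := by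
      rw [ENNReal.ofReal_pow (by norm_num), one_div, ENNReal.ofReal_inv_of_pos (by norm_num)]
      simp
    rw [e1, ← ENNReal.ofReal_natCast, ← ENNReal.ofReal_natCast,
      ← ENNReal.ofReal_mul (by positivity), ← ENNReal.ofReal_mul (by positivity),
      ← ENNReal.ofReal_mul (by positivity)]
    refine ENNReal.ofReal_le_ofReal ?_
    have c1 : ((F m).card : ℝ) ≤ N * (2 ^ d) ^ m := by exact_mod_cast hFcard m
    have c2 : ((F (m + 1)).card : ℝ) ≤ N * (2 ^ d) ^ (m + 1) := by exact_mod_cast hFcard (m + 1)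
    calc ((F m).card : ℝ) * (F (m + 1)).card * ((ρ ^ k) ^ m * Q)
        ≤ (N * (2 ^ d) ^ m) * (N * (2 ^ d) ^ (m + 1)) * ((ρ ^ k) ^ m * Q) := by gcongr
      _ = N ^ 2 * 2 ^ d * Q * (ρ ^ k * 4 ^ d) ^ m := by
          rw [mul_pow (ρ ^ k), show (4 : ℝ) = 2 * 2 by norm_num, mul_pow 2 2, mul_pow (2 ^ d)]
          ring
      _ ≤ N ^ 2 * 2 ^ d * Q * (1 / 2) ^ m := by gcongr
  refine ⟨n₀, k, η, 1 + 2 / (1 - q), fun ω => ∑' m, ∑ s ∈ F m, ∑ t ∈ F (m + 1), term m s t ω,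
    hk₂.trans (by exact_mod_cast le_max_right _ _), hη0, ?_, ?_, ?_⟩
  · have : 0 < 1 - q := by linarith
    positivity
  · rw [lintegral_tsum fun m => (Finset.measurable_sum _ fun s _ =>
      Finset.measurable_sum _ fun t _ => hterm_meas m s t).aemeasurable]
    refine ne_top_of_le_ne_top ?_ (ENNReal.tsum_le_tsum hscale_int)
    rw [ENNReal.tsum_mul_left, ENNReal.tsum_geometric]
    refine ENNReal.mul_ne_top (ENNReal.mul_ne_top ENNReal.ofReal_ne_top hGtop) ?_
    rw [ENNReal.one_sub_inv_two, inv_inv]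
    exact ENNReal.ofNat_ne_top
  · filter_upwards [hcont] with ω hω n hn s hs t ht hst x hx hlt
    by_contra hcon
    refine absurd hlt (not_lt.mpr ?_)
    refine abs_sub_le_of_net_increments hFT hF hω hx.le hq0 hq1 ?_ hs ht hst
    intro m hm s' hs' t' ht' hnear
    by_contra hbig
    rw [not_le] at hbig
    refine hcon ?_
    have hqm : 0 < q ^ m := by positivity
    have hle : ENNReal.ofReal (Φ (x ^ 2)) ≤ term m s' t' ω := by
      have h : n₀ ≤ m ∧ nrm (s' - t') ≤ D * (1 / 2 : ℝ) ^ m := ⟨hn.trans hm, hnear⟩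
      simp only [term, if_pos h]
      refine ENNReal.ofReal_le_ofReal (hΦmono _ _ (by positivity) ?_)
      rw [← sq_abs (_ / _), abs_div, abs_of_pos hqm]
      gcongr
      rw [le_div_iff₀ hqm]
      exact hbig.le
    refine hle.trans ?_
    refine le_trans ?_ (ENNReal.le_tsum m)
    refine le_trans ?_ (Finset.single_le_sum (f := fun s => ∑ t ∈ F (m + 1), term m s t ω)
      (fun _ _ => zero_le) hs')
    exact Finset.single_le_sum (f := fun t => term m s' t ω) (fun _ _ => zero_le) ht'

lemma measurable_volume_excursion {Ω : Type*} [MeasurableSpace Ω] {P : Measure Ω} [SFinite P]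
    {d : ℕ} {T : Set (Fin d → ℝ)} (hT : IsCompact T)
    {f : (Fin d → ℝ) → Ω → ℝ} (hfm : ∀ t, Measurable (f t))
    (hcont : ∀ᵐ ω ∂P, ContinuousOn (fun t => f t ω) T) (u : ℝ) :
    AEMeasurable (fun ω => volume {t | t ∈ T ∧ f t ω > u}) P ∧
      ∀ c : ENNReal, (∀ t ∈ T, c ≤ P {ω | f t ω > u}) →
        c * volume T ≤ ∫⁻ ω, volume {t | t ∈ T ∧ f t ω > u} ∂P := by
  obtain ⟨N, hN, hNm, hN0⟩ := exists_measurable_superset_of_null (ae_iff.mp hcont)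
  have hNae : ∀ᵐ ω ∂P, ω ∈ Nᶜ := measure_eq_zero_iff_ae_notMem.mp hN0
  have hTm : MeasurableSet T := hT.isClosed.measurableSet
  let g : T → Ω → ℝ := fun t => Nᶜ.indicator (f t)
  have hgm : ∀ t, Measurable (g t) := fun t => (hfm t).indicator hNm.compl
  have hgc : ∀ ω, Continuous fun t => g t ω := by
    intro ω
    by_cases hω : ω ∈ N
    · simpa [g, hω] using continuous_const
    · have : ContinuousOn (fun t => f t ω) T := by
        by_contra h
        exact hω (hN h)
      have hc := continuousOn_iff_continuous_domRestrict.mp this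
      simp only [g, Set.indicator_of_mem (show ω ∈ Nᶜ from hω)]
      exact hc
  have hA : MeasurableSet {x : T × Ω | u < Function.uncurry g x} :=
    measurableSet_lt measurable_const (measurable_uncurry_of_continuous_of_measurable hgc hgm)
  let V : Measure T := volume.comap Subtype.val
  have hV : ∀ A : Set (Fin d → ℝ), V (Subtype.val ⁻¹' A) = volume (A ∩ T) := by
    intro A
    rw [comap_subtype_coe_apply hTm, Subtype.image_preimage_coe, Set.inter_comm]
  have hVuniv : V Set.univ = volume T := by
    have := hV Set.univ
    rwa [Set.preimage_univ, Set.univ_inter] at this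
  have : IsFiniteMeasure V := ⟨by rw [hVuniv]; exact hT.measure_lt_top⟩
  have heq : (fun ω => volume {t | t ∈ T ∧ f t ω > u}) =ᵐ[P]
      fun ω => V ((fun t => (t, ω)) ⁻¹' {x : T × Ω | u < Function.uncurry g x}) := by
    filter_upwards [hNae] with ω hω
    have h1 : (fun t : T => (t, ω)) ⁻¹' {x : T × Ω | u < Function.uncurry g x}
        = Subtype.val ⁻¹' {t | f t ω > u} := by
      ext t
      simp [g, Function.uncurry, Set.indicator_of_mem hω]
    rw [h1, hV]
    congr 1
    ext t
    exact and_comm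
  refine ⟨(measurable_measure_prodMk_right hA).aemeasurable.congr heq.symm, fun c hc => ?_⟩
  rw [lintegral_congr_ae heq, ← Measure.prod_apply_symm hA, Measure.prod_apply hA, ← hVuniv,
    ← lintegral_const]
  refine lintegral_mono fun t => (hc t t.2).trans ?_
  refine measure_mono_ae ?_
  filter_upwards [hNae] with ω hω hlt
  have hlt' : u < f t ω := hlt
  change u < g t ω
  simpa only [g, Set.indicator_of_mem hω] using hlt'

lemma gaussian_moments_of_law {Ω : Type*} [MeasurableSpace Ω] {P : Measure Ω}
    {X : Ω → ℝ} (hX : Measurable X) {m : ℝ} {v : NNReal} (h : P.map X = gaussianReal m v) :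
    MemLp X 2 P ∧ ∫ ω, X ω ∂P = m ∧ Var[X; P] = v := by
  have hl : HasLaw X (gaussianReal m v) P := ⟨hX.aemeasurable, h⟩
  refine ⟨?_, ?_, ?_⟩
  · have := memLp_id_gaussianReal (μ := m) (v := v) 2
    rw [← h] at this
    exact this.comp_of_map hX.aemeasurable
  · rw [hl.integral_eq, integral_id_gaussianReal]
  · rw [hl.variance_eq, variance_id_gaussianReal]

/-- If `f s` exceeds `b` while the excursion set above a lower level is too small to fill a ball
around `s`, then `f` falls below the lower level within that ball. -/
lemma exists_near_le_of_volume_lt {d : ℕ} {T : Set (Fin d → ℝ)} (hT : IsCompact T)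
    {g : (Fin d → ℝ) → ℝ} {u ε : ℝ} {s : Fin d → ℝ}
    (h : (volume {t | t ∈ T ∧ g t > u}).toReal < (volume ({t | nrm (t - s) ≤ ε} ∩ T)).toReal) :
    ∃ t ∈ T, nrm (s - t) ≤ ε ∧ g t ≤ u := by
  by_contra! hcon
  refine absurd h (not_lt.mpr ?_)
  have hfin : volume {t | t ∈ T ∧ g t > u} ≠ ⊤ :=
    ((measure_mono fun t (ht : t ∈ T ∧ g t > u) => ht.1).trans_lt hT.measure_lt_top).ne
  refine ENNReal.toReal_mono hfin (measure_mono fun t ht => ⟨ht.2, hcon t ht.2 ?_⟩)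
  rw [nrm_sub_comm]
  exact ht.1

/-- The scale at which a ball has volume just above `m`, for `r` the dyadic volume ratio. -/
lemma exists_scale {A r m : ℝ} {n₀ : ℕ} (hA : 0 < A) (hr0 : 0 < r) (hr1 : r < 1) (hm : 0 < m)
    (hsmall : 2 * m ≤ A * r ^ (n₀ + 1)) :
    ∃ n, n₀ ≤ n ∧ m < A * r ^ n ∧ m⁻¹ ≤ 2 / (A * r) * (r⁻¹) ^ n := by
  have hle : 2 * m / A ≤ r ^ (n₀ + 1) := by rw [div_le_iff₀ hA]; linarith
  obtain ⟨n, hn1, hn2⟩ := exists_nat_pow_near_of_lt_one (x := 2 * m / A) (by positivity)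
    (hle.trans (pow_le_one₀ hr0.le hr1.le)) hr0 hr1
  refine ⟨n, ?_, ?_, ?_⟩
  · have := (pow_lt_pow_iff_right_of_lt_one₀ hr0 hr1).mp (hn1.trans_le hle)
    omega
  · rw [div_le_iff₀ hA] at hn2
    linarith
  · rw [lt_div_iff₀ hA] at hn1
    have h2 : (A * r ^ (n + 1) / 2)⁻¹ = 2 / (A * r) * (r⁻¹) ^ n := by
      rw [pow_succ, inv_pow]; field_simp
    rw [← h2]
    exact inv_anti₀ (by positivity) (by linarith)

lemma mul_exp_le_of_scale {K p L w x i η : ℝ} {k : ℕ} (hK : 0 < K) (hp : 0 < p) (hL : 1 ≤ L)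
    (hw : 1 ≤ w) (hx : 0 < x) (hpk : p ≤ k) (hη : 0 < η)
    (hi : i ≤ K * (x * w) ^ p) (hlow : K * L ^ p * w ^ (2 * p) ≤ i) :
    i * Real.exp (η * L ^ 2 * w ^ 2) ≤ K * ((x ^ 2) ^ k * Real.exp (η * x ^ 2)) := by
  have hw0 : 0 < w := by linarith
  have hL0 : 0 < L := by linarith
  have h1 : (L * (w * w)) ^ p ≤ (x * w) ^ p := by
    have h := hlow.trans hi
    rw [mul_assoc, mul_le_mul_iff_right₀ hK, two_mul, Real.rpow_add hw0,
      ← Real.mul_rpow hw0.le hw0.le, ← Real.mul_rpow hL0.le (by positivity)] at h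
    exact h
  have h2 : L * w ≤ x := by
    have := (Real.rpow_le_rpow_iff (by positivity) (by positivity) hp).mp h1
    rw [← mul_assoc] at this
    exact le_of_mul_le_mul_right this hw0
  have hwx : w ≤ x := (le_mul_of_one_le_left hw0.le hL).trans h2
  have h3 : i ≤ K * (x ^ 2) ^ k := by
    refine hi.trans (mul_le_mul_of_nonneg_left ?_ hK.le)
    rw [← Real.rpow_natCast (x ^ 2) k]
    refine (Real.rpow_le_rpow (by positivity) (?_ : x * w ≤ x ^ 2) hp.le).trans
      (Real.rpow_le_rpow_of_exponent_le ?_ hpk)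
    · rw [sq]; gcongr
    · exact one_le_pow₀ (hw.trans hwx)
  rw [← mul_assoc]
  refine mul_le_mul h3 (Real.exp_le_exp.mpr ?_) (Real.exp_pos _).le (by positivity)
  rw [mul_assoc, ← mul_pow]
  gcongr

lemma setIntegral_le_mul_toReal_lintegral {Ω : Type*} [MeasurableSpace Ω] {P : Measure Ω}
    {g : Ω → ℝ} (hg : ∀ ω, 0 ≤ g ω) {E : Set Ω} (hE : NullMeasurableSet E P) {c : ℝ} (hc : 0 ≤ c)
    {S : Ω → ENNReal} (hS : ∫⁻ ω, S ω ∂P ≠ ⊤)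
    (h : ∀ᵐ ω ∂P, ω ∈ E → ENNReal.ofReal (g ω) ≤ ENNReal.ofReal c * S ω) :
    ∫ ω in E, g ω ∂P ≤ c * (∫⁻ ω, S ω ∂P).toReal := by
  by_cases hm : AEStronglyMeasurable g (P.restrict E)
  swap
  · rw [integral_non_aestronglyMeasurable hm]
    positivity
  rw [integral_eq_lintegral_of_nonneg_ae (Eventually.of_forall hg) hm,
    ← ENNReal.toReal_ofReal hc, ← ENNReal.toReal_mul]
  refine ENNReal.toReal_mono (ENNReal.mul_ne_top ENNReal.ofReal_ne_top hS) ?_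
  calc ∫⁻ ω in E, ENNReal.ofReal (g ω) ∂P ≤ ∫⁻ ω in E, ENNReal.ofReal c * S ω ∂P :=
        lintegral_mono_ae ((ae_restrict_iff'₀ hE).mpr h)
    _ ≤ ∫⁻ ω, ENNReal.ofReal c * S ω ∂P := setLIntegral_le_lintegral _ _
    _ = ENNReal.ofReal c * ∫⁻ ω, S ω ∂P := lintegral_const_mul' _ _ ENNReal.ofReal_ne_top

section GaussianField

variable {Ω : Type*} [MeasurableSpace Ω] {P : Measure Ω} {d : ℕ} {T : Set (Fin d → ℝ)}
  {f : (Fin d → ℝ) → Ω → ℝ}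

lemma exists_gaussian_law_eval
    (hGauss : ∀ (n : ℕ) (t : Fin n → (Fin d → ℝ)), (∀ i, t i ∈ T) →
      ∀ c : Fin n → ℝ, ∃ (m : ℝ) (v : NNReal),
        Measure.map (fun ω => ∑ i, c i * f (t i) ω) P = gaussianReal m v)
    {t : Fin d → ℝ} (ht : t ∈ T) : ∃ (m : ℝ) (v : NNReal), P.map (f t) = gaussianReal m v := by
  simpa using hGauss 1 (fun _ => t) (fun _ => ht) (fun _ => 1)

lemma exists_gaussian_law_sub
    (hGauss : ∀ (n : ℕ) (t : Fin n → (Fin d → ℝ)), (∀ i, t i ∈ T) →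
      ∀ c : Fin n → ℝ, ∃ (m : ℝ) (v : NNReal),
        Measure.map (fun ω => ∑ i, c i * f (t i) ω) P = gaussianReal m v)
    {s t : Fin d → ℝ} (hs : s ∈ T) (ht : t ∈ T) :
    ∃ (m : ℝ) (v : NNReal), P.map (fun ω => f s ω - f t ω) = gaussianReal m v := by
  have := hGauss 2 ![s, t] (by intro i; fin_cases i <;> simpa) ![1, -1]
  simpa [Fin.sum_univ_two, sub_eq_add_neg] using this

lemma gaussian_increment_second_moment_le [IsProbabilityMeasure P]
    (hfmeas : ∀ t, Measurable (f t))
    (hGauss : ∀ (n : ℕ) (t : Fin n → (Fin d → ℝ)), (∀ i, t i ∈ T) →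
      ∀ c : Fin n → ℝ, ∃ (m : ℝ) (v : NNReal),
        Measure.map (fun ω => ∑ i, c i * f (t i) ω) P = gaussianReal m v)
    {μ : (Fin d → ℝ) → ℝ} {C : (Fin d → ℝ) → (Fin d → ℝ) → ℝ} {σ : (Fin d → ℝ) → ℝ}
    (hμ : ∀ t ∈ T, μ t = ∫ ω, f t ω ∂P)
    (hC : ∀ s ∈ T, ∀ t ∈ T, C s t = ∫ ω, (f s ω - μ s) * (f t ω - μ t) ∂P)
    (hσ : ∀ t ∈ T, σ t = Real.sqrt (C t t)) (hσpos : ∀ t ∈ T, 0 < σ t)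
    {β κH δ : ℝ} (hβ : 0 < β) (hκH : 0 < κH) (hδ : 0 < δ)
    (hA2 : ∀ s ∈ T, ∀ t ∈ T, nrm (s - t) < δ →
      |σ t - σ s| + |μ t - μ s| ≤ κH * nrm (s - t) ^ β)
    (hA3 : ∀ s ∈ T, ∀ s' ∈ T, ∀ t ∈ T, ∀ t' ∈ T,
      nrm (t - t') < δ → nrm (s - s') < δ →
      |C t s / (σ t * σ s) - C t' s' / (σ t' * σ s')| ≤
        κH * (nrm (t - t') ^ β + nrm (s - s') ^ β))
    {σmax : ℝ} (hσmax : ∀ t ∈ T, σ t ≤ σmax)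
    {s t : Fin d → ℝ} (hs : s ∈ T) (ht : t ∈ T) (hst : nrm (s - t) < min δ 1) :
    ∃ (m : ℝ) (v : NNReal), P.map (fun ω => f s ω - f t ω) = gaussianReal m v ∧
        m ^ 2 ≤ (κH ^ 2 + 2 * σmax ^ 2 * κH) * nrm (s - t) ^ β ∧
        (v : ℝ) ≤ (κH ^ 2 + 2 * σmax ^ 2 * κH) * nrm (s - t) ^ β := by
  have hstδ := hst.trans_le (min_le_left _ _)
  obtain ⟨m, v, hmap⟩ := exists_gaussian_law_sub hGauss hs ht
  obtain ⟨ms, vs, hmaps⟩ := exists_gaussian_law_eval hGauss hs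
  obtain ⟨mt, vt, hmapt⟩ := exists_gaussian_law_eval hGauss ht
  obtain ⟨hLs, -, hVs⟩ := gaussian_moments_of_law (hfmeas s) hmaps
  obtain ⟨hLt, -, hVt⟩ := gaussian_moments_of_law (hfmeas t) hmapt
  obtain ⟨-, hmean, hvar⟩ := gaussian_moments_of_law ((hfmeas s).sub (hfmeas t)) hmap
  have hm : m = μ s - μ t := by
    rw [← hmean, hμ s hs, hμ t ht]
    exact integral_sub (hLs.integrable (by norm_num)) (hLt.integrable (by norm_num))
  have hcov : ∀ s' ∈ T, ∀ t' ∈ T, cov[f s', f t'; P] = C s' t' := by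
    intro s' hs' t' ht'
    rw [hC s' hs' t' ht', covariance, hμ s' hs', hμ t' ht']
  have hvareq : ∀ u ∈ T, Var[f u; P] = σ u ^ 2 := by
    intro u hu
    have h1 : Var[f u; P] = C u u := by
      rw [← covariance_self (hfmeas u).aemeasurable, hcov u hu u hu]
    rw [hσ u hu, Real.sq_sqrt (h1 ▸ variance_nonneg _ _), h1]
  have hcc : ∀ u ∈ T, C u u = σ u ^ 2 := by
    intro u hu
    rw [← hvareq u hu, ← covariance_self (hfmeas u).aemeasurable, hcov u hu u hu]
  have hσs := hσpos s hs
  have hσt := hσpos t ht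
  have hv : (v : ℝ) = σ s ^ 2 - 2 * C t s + σ t ^ 2 := by
    rw [← hvar, ← hvareq s hs, ← hvareq t ht, ← hcov t ht s hs, covariance_comm]
    exact variance_sub hLs hLt
  set h : ℝ := nrm (s - t) ^ β with hh
  have hh0 : 0 ≤ h := Real.rpow_nonneg (nrm_nonneg _) _
  have hh1 : h ≤ 1 := Real.rpow_le_one (nrm_nonneg _) (hst.trans_le (min_le_right _ _)).le hβ.le
  have hhh : h ^ 2 ≤ h := by nlinarith
  have h2 := hA2 s hs t ht hstδ
  have h3 := hA3 s hs t ht t ht t ht (by simpa using hδ) hstδ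
  rw [sub_self, nrm_zero, Real.zero_rpow hβ.ne', zero_add, hcc t ht,
    show σ t ^ 2 / (σ t * σ t) = 1 by field_simp] at h3
  have hsqbd : ∀ y : ℝ, |y| ≤ κH * h → y ^ 2 ≤ κH ^ 2 * h := by
    intro y hy
    calc y ^ 2 = |y| ^ 2 := (sq_abs y).symm
      _ ≤ (κH * h) ^ 2 := by gcongr
      _ = κH ^ 2 * h ^ 2 := by ring
      _ ≤ κH ^ 2 * h := by gcongr
  have h4 : (μ t - μ s) ^ 2 ≤ κH ^ 2 * h := hsqbd _ (by linarith [abs_nonneg (σ t - σ s)])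
  have h5 : (σ t - σ s) ^ 2 ≤ κH ^ 2 * h := hsqbd _ (by linarith [abs_nonneg (μ t - μ s)])
  have h6 : 0 ≤ σmax ^ 2 * κH * h := by positivity
  refine ⟨m, v, hmap, ?_, ?_⟩
  · rw [hm]; nlinarith
  · have h7 : 1 - C t s / (σ t * σ s) ≤ κH * h := by linarith [(abs_le.mp h3).1]
    have h8 : σ t * σ s - C t s = σ t * σ s * (1 - C t s / (σ t * σ s)) := by field_simp
    have h9 : σ t * σ s ≤ σmax ^ 2 := by
      rw [sq]
      exact mul_le_mul (hσmax t ht) (hσmax s hs) hσs.le (hσt.le.trans (hσmax t ht))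
    have h10 : σ t * σ s - C t s ≤ σmax ^ 2 * κH * h := by
      have h11 : 0 ≤ κH * h := by positivity
      calc σ t * σ s - C t s ≤ σ t * σ s * (κH * h) := by
            rw [h8]; exact mul_le_mul_of_nonneg_left h7 (by positivity)
        _ ≤ σmax ^ 2 * (κH * h) := mul_le_mul_of_nonneg_right h9 h11
        _ = σmax ^ 2 * κH * h := by ring
    rw [hv]
    nlinarith

lemma exists_exceedance_lower_bound [IsProbabilityMeasure P] (hfmeas : ∀ t, Measurable (f t))
    (hGauss : ∀ (n : ℕ) (t : Fin n → (Fin d → ℝ)), (∀ i, t i ∈ T) →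
      ∀ c : Fin n → ℝ, ∃ (m : ℝ) (v : NNReal),
        Measure.map (fun ω => ∑ i, c i * f (t i) ω) P = gaussianReal m v)
    {μ : (Fin d → ℝ) → ℝ} {C : (Fin d → ℝ) → (Fin d → ℝ) → ℝ} {σ : (Fin d → ℝ) → ℝ}
    (hμ : ∀ t ∈ T, μ t = ∫ ω, f t ω ∂P)
    (hC : ∀ s ∈ T, ∀ t ∈ T, C s t = ∫ ω, (f s ω - μ s) * (f t ω - μ t) ∂P)
    (hσ : ∀ t ∈ T, σ t = Real.sqrt (C t t))
    {μmax σmin : ℝ} (hμmax : ∀ t ∈ T, |μ t| ≤ μmax) (hσmin : 0 < σmin)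
    (hσmin' : ∀ t ∈ T, σmin ≤ σ t) (hμ0 : 0 ≤ μmax) :
    ∃ c₁ C₁ : ℝ, 0 < c₁ ∧ 0 < C₁ ∧ ∀ b : ℝ, 1 ≤ b → ∀ u ≤ b, ∀ t ∈ T,
      ENNReal.ofReal (c₁ * Real.exp (-(C₁ * b ^ 2))) ≤ P {ω | f t ω > u} := by
  set R : ℝ := (1 + μmax) / σmin with hR
  have hR0 : 0 < R := by positivity
  refine ⟨(Real.sqrt (2 * Real.pi))⁻¹, (R + 1) ^ 2 / 2, by positivity, by positivity, ?_⟩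
  intro b hb u hu t ht
  obtain ⟨m, v, hmap⟩ := exists_gaussian_law_eval hGauss ht
  obtain ⟨-, hmean, hvar⟩ := gaussian_moments_of_law (hfmeas t) hmap
  have hm : m = μ t := by rw [← hmean, hμ t ht]
  have hv : Real.sqrt v = σ t := by
    rw [hσ t ht, hC t ht t ht, ← hvar, ← covariance_self (hfmeas t).aemeasurable, covariance,
      hμ t ht]
  have hσt : 0 < σ t := hσmin.trans_le (hσmin' t ht)
  have hv0 : v ≠ 0 := by
    rintro rfl
    simp at hv
    exact hσt.ne hv
  have hset : P {ω | f t ω > u} = gaussianReal m v (Set.Ioi u) := by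
    rw [← hmap, Measure.map_apply (hfmeas t) measurableSet_Ioi]
    rfl
  rw [hset]
  refine le_trans (ENNReal.ofReal_le_ofReal ?_)
    (le_gaussianReal_Ioi (y := R * b) (by positivity) ?_ hv0)
  · gcongr
    have : R * b + 1 ≤ (R + 1) * b := by linarith
    have : (R * b + 1) ^ 2 ≤ ((R + 1) * b) ^ 2 := by gcongr
    linarith [mul_pow (R + 1) b 2]
  · rw [hv, hm]
    have h1 := (abs_le.mp (hμmax t ht)).1
    have h2 : (1 + μmax) * b ≤ σ t * (R * b) := by
      have h3 : σmin * (R * b) = (1 + μmax) * b := by rw [hR]; field_simp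
      rw [← h3]
      exact mul_le_mul_of_nonneg_right (hσmin' t ht) (by positivity)
    nlinarith

end GaussianField

lemma exp_neg_mul_div_le {M m c : ℝ} (hM : 0 < M) (hm : 0 < m) (hc : 0 < c) :
    Real.exp (-M * m / c) ≤ c / M * m⁻¹ := by
  have h : 0 < M * m / c := by positivity
  rw [show -M * m / c = -(M * m / c) by ring, Real.exp_neg,
    show c / M * m⁻¹ = (M * m / c)⁻¹ by field_simp]
  exact inv_anti₀ h (by linarith [Real.add_one_le_exp (M * m / c)])

lemma inv_pow_eq_rpow_of_rpow_eq {q p r : ℝ} (hq : 0 < q) (h : q ^ p = r) (n : ℕ) :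
    (r⁻¹) ^ n = ((q ^ n)⁻¹) ^ p := by
  rw [← h, Real.inv_rpow (by positivity), inv_pow, ← Real.rpow_natCast, ← Real.rpow_natCast,
    ← Real.rpow_mul hq.le, ← Real.rpow_mul hq.le, mul_comm]

/-- Pathwise domination on the event that the excursion set above `b - a / b` is small while `b` is
exceeded: `g` must drop by `a / b` within a short distance, which the oscillation bound `S` makes
costly. -/
lemma exp_le_mul_of_small_volume {d : ℕ} {T : Set (Fin d → ℝ)} (hT : IsCompact T)
    {g : (Fin d → ℝ) → ℝ} {A r q p η D L C₁ mT M a b : ℝ} {S : ENNReal} {n₀ N₁ k : ℕ}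
    (hA : 0 < A) (hr0 : 0 < r) (hr1 : r < 1) (hq : 0 < q) (hp : 0 < p) (hqr : q ^ p = r)
    (hpk : p ≤ k) (hη : 0 < η) (hD : 0 < D) (hL : 1 ≤ L) (hηL : C₁ ≤ η * L ^ 2)
    (hmT : 0 < mT) (hM : 0 < M)
    (hball : ∀ t ∈ T, ∀ n, max n₀ N₁ ≤ n →
      A * r ^ n ≤ (volume ({s | nrm (s - t) ≤ (1 / 2 : ℝ) ^ n} ∩ T)).toReal)
    (hosc : ∀ n, n₀ ≤ n → ∀ s ∈ T, ∀ t ∈ T, nrm (s - t) ≤ (1 / 2 : ℝ) ^ n → ∀ x : ℝ, 0 < x →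
      D * x * q ^ n < |g s - g t| → ENNReal.ofReal ((x ^ 2) ^ k * Real.exp (η * x ^ 2)) ≤ S)
    (ha : 0 < a) (ha1 : a < 1) (hb : 1 ≤ b)
    (hpos : 0 < (volume {t | t ∈ T ∧ g t > b - a / b}).toReal)
    (hposb : 0 < (volume {t | t ∈ T ∧ g t > b}).toReal)
    (hsmall : (2 / (A * r) * (2 * D) ^ p * L ^ p + 2 / (A * r ^ (max n₀ N₁ + 1))) *
      (b / a) ^ (2 * p) ≤ ((volume {t | t ∈ T ∧ g t > b - a / b}).toReal)⁻¹) :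
    ENNReal.ofReal (Real.exp (-M * (volume {t | t ∈ T ∧ g t > b - a / b}).toReal / mT)) ≤
      ENNReal.ofReal (mT / M * Real.exp (-(C₁ * b ^ 2)) * (2 / (A * r) * (2 * D) ^ p)) * S := by
  have hb0 : 0 < b := by linarith
  obtain ⟨m, hm⟩ : ∃ m, m = (volume {t | t ∈ T ∧ g t > b - a / b}).toReal := ⟨_, rfl⟩
  obtain ⟨K, hK⟩ : ∃ K, K = 2 / (A * r) * (2 * D) ^ p := ⟨_, rfl⟩
  obtain ⟨w, hw⟩ : ∃ w, w = b / a := ⟨_, rfl⟩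
  have hvol := hm.symm.le
  rw [← hm] at hpos hsmall ⊢
  rw [← hK] at hsmall ⊢
  rw [← hw] at hsmall
  have hK0 : 0 < K := by rw [hK]; positivity
  have hbw : b ≤ w := by rw [hw, le_div_iff₀ ha]; nlinarith
  have hw1 : 1 ≤ w := hb.trans hbw
  have hw0 : 0 < w := by linarith
  have hwp : 1 ≤ w ^ (2 * p) := Real.one_le_rpow hw1 (by positivity)
  have hR0 : 0 < 2 / (A * r ^ (max n₀ N₁ + 1)) := by positivity
  have hKL : 0 < K * L ^ p := by positivity
  have hsmall1 : K * L ^ p * w ^ (2 * p) ≤ m⁻¹ := by nlinarith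
  have hsmall2 : 2 * m ≤ A * r ^ (max n₀ N₁ + 1) := by
    have h1 : 2 / (A * r ^ (max n₀ N₁ + 1)) ≤ m⁻¹ := by nlinarith
    rw [div_le_iff₀ (by positivity), inv_mul_eq_div, le_div_iff₀ hpos] at h1
    exact h1
  obtain ⟨n, hn, hmn, hinv⟩ := exists_scale hA hr0 hr1 hpos hsmall2
  obtain ⟨s, hsT, hsb⟩ : ∃ s ∈ T, g s > b := by
    by_contra! hcon
    have : {t | t ∈ T ∧ g t > b} = ∅ :=
      Set.eq_empty_of_forall_notMem fun t ht => (hcon t ht.1).not_gt ht.2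
    simp [this] at hposb
  obtain ⟨t, htT, hst, htb⟩ := exists_near_le_of_volume_lt (g := g) hT
    (hvol.trans_lt (hmn.trans_le (hball s hsT n hn)))
  have hqn : 0 < q ^ n := by positivity
  have hab : 0 < a / b := by positivity
  obtain ⟨x, hx⟩ : ∃ x, x = a / b / (2 * D * q ^ n) := ⟨_, rfl⟩
  have hx0 : 0 < x := by rw [hx]; positivity
  have hjump : D * x * q ^ n < |g s - g t| := by
    have h1 : D * x * q ^ n = a / b / 2 := by rw [hx]; field_simp
    rw [h1]
    exact lt_of_lt_of_le (by linarith) (le_abs_self _)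
  have hSx := hosc n ((le_max_left _ _).trans hn) s hsT t htT hst x hx0 hjump
  have hi : m⁻¹ ≤ K * (x * w) ^ p := by
    refine hinv.trans (le_of_eq ?_)
    have h1 : (q ^ n)⁻¹ = 2 * D * (x * w) := by rw [hx, hw]; field_simp
    rw [inv_pow_eq_rpow_of_rpow_eq hq hqr, h1, Real.mul_rpow (by positivity) (by positivity), hK,
      mul_assoc]
  have hcore := mul_exp_le_of_scale hK0 hp hL hw1 hx0 hpk hη hi hsmall1
  have hone : 1 ≤ Real.exp (-(C₁ * b ^ 2)) * Real.exp (η * L ^ 2 * w ^ 2) := by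
    rw [← Real.exp_add]
    refine Real.one_le_exp ?_
    have : C₁ * b ^ 2 ≤ η * L ^ 2 * w ^ 2 := by gcongr
    linarith
  have hexp : Real.exp (-M * m / mT)
      ≤ mT / M * Real.exp (-(C₁ * b ^ 2)) * (m⁻¹ * Real.exp (η * L ^ 2 * w ^ 2)) := by
    calc Real.exp (-M * m / mT) ≤ mT / M * m⁻¹ := exp_neg_mul_div_le hM hpos hmT
      _ ≤ mT / M * m⁻¹ * (Real.exp (-(C₁ * b ^ 2)) * Real.exp (η * L ^ 2 * w ^ 2)) :=
        le_mul_of_one_le_right (by positivity) hone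
      _ = _ := by ring
  calc ENNReal.ofReal (Real.exp (-M * m / mT))
      ≤ ENNReal.ofReal (mT / M * Real.exp (-(C₁ * b ^ 2)) *
          (K * ((x ^ 2) ^ k * Real.exp (η * x ^ 2)))) :=
        ENNReal.ofReal_le_ofReal (hexp.trans (mul_le_mul_of_nonneg_left hcore (by positivity)))
    _ = ENNReal.ofReal (mT / M * Real.exp (-(C₁ * b ^ 2)) * K) *
          ENNReal.ofReal ((x ^ 2) ^ k * Real.exp (η * x ^ 2)) := by
        rw [← ENNReal.ofReal_mul (by positivity), ← mul_assoc _ K]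
    _ ≤ _ := mul_le_mul_right hSx _

/-- Proposition `PropSimplify`.  Under Conditions A1–A4 with Hölder
exponent `β`: for any `v > 0` there exist constants `κ, λ₂ ∈ (0,∞)`, independent of
`a ∈ (0,1)` and of `b`, such that whenever `α⁻¹ ≥ κ^{d/β} (b/a)^{(2+v)·2d/β}` and `M ≥ 1`,
`E[exp(−M m(A_{γ_{a,b}})/m(T)); 0 < m(A_{γ_{a,b}}) ≤ α, m(A_b) > 0]
  ≤ E[m(A_{γ_{a,b}})] · E[W²] · (m(T)/(λ₂^{2d/β} M)) · (b/a)^{4d/β}`,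
where `W ≥ 0` has `P(W > x) = exp(−x^{β/d})`, so that `E[W²] = Γ(1 + 2d/β)`. -/
theorem small_excursion_set_bound
    {Ω : Type} [MeasureSpace Ω] [IsProbabilityMeasure (ℙ : Measure Ω)]
    {d : ℕ} (hd : 0 < d)
    (T : Set (Fin d → ℝ)) (hTcompact : IsCompact T) (h0T : (0 : Fin d → ℝ) ∈ T)
    (f : (Fin d → ℝ) → Ω → ℝ) (hfmeas : ∀ t, Measurable (f t))
    -- `f` is a Gaussian random field on `T`
    (hGauss : ∀ (n : ℕ) (t : Fin n → (Fin d → ℝ)), (∀ i, t i ∈ T) →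
      ∀ c : Fin n → ℝ, ∃ (m : ℝ) (v : NNReal),
        Measure.map (fun ω => ∑ i, c i * f (t i) ω) (ℙ : Measure Ω) = gaussianReal m v)
    -- mean, covariance and standard deviation functions
    (μ : (Fin d → ℝ) → ℝ) (C : (Fin d → ℝ) → (Fin d → ℝ) → ℝ) (σ : (Fin d → ℝ) → ℝ)
    (hμ : ∀ t ∈ T, μ t = ∫ ω, f t ω)
    (hC : ∀ s ∈ T, ∀ t ∈ T, C s t = ∫ ω, (f s ω - μ s) * (f t ω - μ t))
    (hσ : ∀ t ∈ T, σ t = Real.sqrt (C t t)) (hσpos : ∀ t ∈ T, 0 < σ t)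
    -- Condition A1: almost sure continuity on T
    (hA1 : ∀ᵐ ω ∂(ℙ : Measure Ω), ContinuousOn (fun t => f t ω) T)
    -- Conditions A2 and A3, with Hölder exponent `β` and constant `κH`
    (β κH δ : ℝ) (hβ : 0 < β) (hκH : 0 < κH) (hδ : 0 < δ)
    (hA2 : ∀ s ∈ T, ∀ t ∈ T, nrm (s - t) < δ →
      |σ t - σ s| + |μ t - μ s| ≤ κH * nrm (s - t) ^ β)
    (hA3 : ∀ s ∈ T, ∀ s' ∈ T, ∀ t ∈ T, ∀ t' ∈ T,
      nrm (t - t') < δ → nrm (s - s') < δ →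
      |C t s / (σ t * σ s) - C t' s' / (σ t' * σ s')| ≤
        κH * (nrm (t - t') ^ β + nrm (s - s') ^ β))
    -- Condition A4
    (κ₀ ε₁ : ℝ) (hκ₀ : 0 < κ₀) (hε₁ : 0 < ε₁)
    (hA4 : ∀ t ∈ T, ∀ ε : ℝ, 0 < ε → ε < ε₁ →
      κ₀ * ε ^ d * (volume {x : Fin d → ℝ | nrm x ≤ 1}).toReal ≤
        (volume ({s | nrm (s - t) ≤ ε} ∩ T)).toReal)
    :
    ∀ v : ℝ, 0 < v →
      ∃ κ lam2 : ℝ, 0 < κ ∧ 0 < lam2 ∧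
        ∀ a : ℝ, 0 < a → a < 1 → ∀ b : ℝ, 1 ≤ b → ∀ α : ℝ, 0 < α →
          κ ^ ((d : ℝ) / β) * (b / a) ^ ((2 + v) * 2 * (d : ℝ) / β) ≤ α⁻¹ →
          ∀ M : ℕ, 1 ≤ M →
            (∫ ω in {ω | 0 < (volume {t | t ∈ T ∧ f t ω > b - a / b}).toReal ∧
                  (volume {t | t ∈ T ∧ f t ω > b - a / b}).toReal ≤ α ∧
                  0 < (volume {t | t ∈ T ∧ f t ω > b}).toReal},
                Real.exp (-(M : ℝ) *
                  (volume {t | t ∈ T ∧ f t ω > b - a / b}).toReal / (volume T).toReal))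
            ≤ (∫ ω, (volume {t | t ∈ T ∧ f t ω > b - a / b}).toReal) *
                Real.Gamma (1 + 2 * (d : ℝ) / β) *
                ((volume T).toReal / (lam2 ^ (2 * (d : ℝ) / β) * (M : ℝ))) *
                (b / a) ^ (4 * (d : ℝ) / β) := by
  intro v hv
  have hd' : (0 : ℝ) < d := by exact_mod_cast hd
  have hne : T.Nonempty := ⟨0, h0T⟩
  -- uniform bounds for the mean and the standard deviation
  have hσcont : ContinuousOn σ T := continuousOn_of_nrm_holder hδ hβ fun s hs t ht hst =>
    (le_add_of_nonneg_right (abs_nonneg _)).trans (hA2 s hs t ht hst)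
  have hμcont : ContinuousOn μ T := continuousOn_of_nrm_holder hδ hβ fun s hs t ht hst =>
    (le_add_of_nonneg_left (abs_nonneg _)).trans (hA2 s hs t ht hst)
  obtain ⟨σmax, hσmax⟩ := hTcompact.exists_bound_of_continuousOn hσcont
  obtain ⟨μmax, hμmax⟩ := hTcompact.exists_bound_of_continuousOn hμcont
  obtain ⟨t₁, ht₁, hσmin⟩ := hTcompact.exists_isMinOn hne hσcont
  obtain ⟨c₁, C₁, hc₁, hC₁, hexc⟩ := exists_exceedance_lower_bound hfmeas hGauss hμ hC hσ hμmax
    (hσpos t₁ ht₁) (fun t ht => hσmin ht) ((norm_nonneg _).trans (hμmax 0 h0T))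
  -- the modulus of continuity at the Hölder exponent `θ = β / (2 + v)`
  set θ : ℝ := β / (2 + v) with hθdef
  have hθ : 0 < θ := by positivity
  have hθβ : 2 * θ < β := by
    rw [hθdef, ← mul_div_assoc, div_lt_iff₀ (by positivity)]
    nlinarith
  set p : ℝ := d / θ with hpdef
  have hp : 0 < p := by positivity
  obtain ⟨n₀, k, η, D, S, hpk, hη, hD, hS, hosc⟩ :=
    exists_integrable_oscillation_bound hTcompact.isBounded hne hfmeas hA1 hβ hθ hθβ
      (lt_min hδ one_pos) (by positivity : 0 ≤ κH ^ 2 + 2 * σmax ^ 2 * κH)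
      (fun s hs t ht hst => gaussian_increment_second_moment_le hfmeas hGauss hμ hC hσ hσpos
        hβ hκH hδ hA2 hA3 (fun t ht => (le_abs_self _).trans (hσmax t ht)) hs ht hst) p
  obtain ⟨n₁, hn₁⟩ : ∃ n₁ : ℕ, (1 / 2 : ℝ) ^ n₁ < ε₁ :=
    exists_pow_lt_of_lt_one hε₁ (by norm_num)
  set N := max n₀ n₁ with hN
  set A : ℝ := κ₀ * (volume {x : Fin d → ℝ | nrm x ≤ 1}).toReal with hA
  have hA0 : 0 < A := mul_pos hκ₀ (volume_nrm_le_one_toReal_pos d)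
  set r : ℝ := (1 / 2 : ℝ) ^ d with hr
  have hr0 : 0 < r := by positivity
  have hr1 : r < 1 := pow_lt_one₀ (by norm_num) (by norm_num) hd.ne'
  set q : ℝ := (1 / 2 : ℝ) ^ θ with hq
  have hq0 : 0 < q := by positivity
  have hqr : q ^ p = r := by
    rw [hq, ← Real.rpow_mul (by norm_num), hpdef, mul_div_cancel₀ _ hθ.ne', hr, Real.rpow_natCast]
  have hball : ∀ t ∈ T, ∀ n, N ≤ n →
      A * r ^ n ≤ (volume ({s | nrm (s - t) ≤ (1 / 2 : ℝ) ^ n} ∩ T)).toReal := by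
    intro t ht n hn
    refine le_trans (le_of_eq ?_) (hA4 t ht ((1 / 2) ^ n) (by positivity) ?_)
    · rw [hA, hr, ← pow_mul, ← pow_mul, mul_comm n d]; ring
    · exact (pow_le_pow_of_le_one (by norm_num) (by norm_num)
        ((le_max_right _ _).trans hn)).trans_lt hn₁
  have hTfin : volume T ≠ ⊤ := hTcompact.measure_lt_top.ne
  set mT : ℝ := (volume T).toReal with hmT
  have hmT0 : 0 < mT := by
    refine (by positivity : 0 < A * r ^ N).trans_le ((hball 0 h0T N le_rfl).trans ?_)
    exact ENNReal.toReal_mono hTfin (measure_mono Set.inter_subset_right)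
  set L : ℝ := 1 + C₁ / η with hL
  have hL1 : 1 ≤ L := le_add_of_nonneg_right (by positivity)
  have hηL : C₁ ≤ η * L ^ 2 := by
    have h1 : η * L = η + C₁ := by rw [hL]; field_simp
    nlinarith
  set K : ℝ := 2 / (A * r) * (2 * D) ^ p with hK
  have hK0 : 0 < K := by positivity
  set Q : ℝ := K * L ^ p + 2 / (A * r ^ (N + 1)) with hQ
  have hQ0 : 0 < Q := by positivity
  set I : ℝ := (∫⁻ ω, S ω).toReal with hI
  have hI0 : 0 ≤ I := ENNReal.toReal_nonneg
  have hΓ : 0 < Real.Gamma (1 + 2 * (d : ℝ) / β) := Real.Gamma_pos_of_pos (by positivity)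
  set Λ : ℝ := mT * c₁ * Real.Gamma (1 + 2 * (d : ℝ) / β) / (K * I + 1) with hΛ
  have hΛ0 : 0 < Λ := by positivity
  refine ⟨Q ^ (β / d), Λ ^ (β / (2 * d)), by positivity, by positivity, ?_⟩
  intro a ha ha1 b hb α hα hαle M hM
  have hb0 : 0 < b := by linarith
  have hM0 : (0 : ℝ) < M := by exact_mod_cast hM
  set w : ℝ := b / a with hw
  have hbw : b ≤ w := by rw [hw, le_div_iff₀ ha]; nlinarith
  have hw1 : 1 ≤ w := hb.trans hbw
  have hw0 : 0 < w := by linarith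
  have hQα : Q * w ^ (2 * p) ≤ α⁻¹ := by
    rw [← Real.rpow_mul hQ0.le, show β / d * (d / β) = 1 by field_simp, Real.rpow_one] at hαle
    rwa [show 2 * p = (2 + v) * 2 * d / β by rw [hpdef, hθdef]; field_simp]
  have hΛlam : (Λ ^ (β / (2 * d))) ^ (2 * (d : ℝ) / β) = Λ := by
    rw [← Real.rpow_mul hΛ0.le, show β / (2 * d) * (2 * d / β) = 1 by field_simp, Real.rpow_one]
  rw [hΛlam]
  set V : ℝ → Ω → ℝ := fun u ω => (volume {t | t ∈ T ∧ f t ω > u}).toReal with hV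
  have hVmeas := fun u => (measurable_volume_excursion hTcompact hfmeas hA1 u).1.ennreal_toReal
  -- pathwise domination on the event of a small excursion set
  have hpath : ∀ᵐ ω, ω ∈ {ω | 0 < V (b - a / b) ω ∧ V (b - a / b) ω ≤ α ∧ 0 < V b ω} →
      ENNReal.ofReal (Real.exp (-(M : ℝ) * V (b - a / b) ω / mT))
        ≤ ENNReal.ofReal (mT / M * Real.exp (-(C₁ * b ^ 2)) * K) * S ω := by
    filter_upwards [hosc] with ω hω ⟨hpos, hle, hposb⟩
    exact exp_le_mul_of_small_volume hTcompact hA0 hr0 hr1 hq0 hp hqr hpk hη hD hL1 hηL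
      hmT0 hM0 hball hω ha ha1 hb hpos hposb (hQα.trans (inv_anti₀ hpos hle))
  have hEmeas : NullMeasurableSet
      {ω | 0 < V (b - a / b) ω ∧ V (b - a / b) ω ≤ α ∧ 0 < V b ω} (ℙ : Measure Ω) :=
    (nullMeasurableSet_lt aemeasurable_const (hVmeas _)).inter
      ((nullMeasurableSet_le (hVmeas _) aemeasurable_const).inter
        (nullMeasurableSet_lt aemeasurable_const (hVmeas _)))
  have hlhs := setIntegral_le_mul_toReal_lintegral
    (g := fun ω => Real.exp (-(M : ℝ) * V (b - a / b) ω / mT)) (fun _ => (Real.exp_pos _).le)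
    hEmeas (by positivity) hS hpath
  have hmean : mT * (c₁ * Real.exp (-(C₁ * b ^ 2))) ≤ ∫ ω, V (b - a / b) ω := by
    have hub : ∀ ω, volume {t | t ∈ T ∧ f t ω > b - a / b} ≤ volume T :=
      fun ω => measure_mono fun t ht => ht.1
    obtain ⟨hae, hfub⟩ := measurable_volume_excursion hTcompact hfmeas hA1 (b - a / b)
    have h1 := hfub _ fun t ht => hexc b hb (b - a / b) (sub_le_self _ (by positivity)) t ht
    have htop : ∫⁻ ω, volume {t | t ∈ T ∧ f t ω > b - a / b} ≠ ⊤ := by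
      refine ne_top_of_le_ne_top ?_ (lintegral_mono hub)
      simpa using hTfin
    rw [hV, integral_toReal hae (Eventually.of_forall fun ω => (hub ω).trans_lt hTfin.lt_top)]
    have h2 := ENNReal.toReal_mono htop h1
    rwa [ENNReal.toReal_mul, ENNReal.toReal_ofReal (by positivity), mul_comm] at h2
  refine hlhs.trans ?_
  have hwexp : 1 ≤ w ^ (4 * (d : ℝ) / β) := Real.one_le_rpow hw1 (by positivity)
  have hEm0 : 0 ≤ ∫ ω, V (b - a / b) ω := le_trans (by positivity) hmean
  calc mT / M * Real.exp (-(C₁ * b ^ 2)) * K * I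
      ≤ mT / M * Real.exp (-(C₁ * b ^ 2)) * (K * I + 1) := by
        rw [mul_assoc _ K I]
        gcongr
        linarith
    _ = mT * (c₁ * Real.exp (-(C₁ * b ^ 2))) * Real.Gamma (1 + 2 * (d : ℝ) / β) *
          (mT / (Λ * M)) * 1 := by
        rw [hΛ]; field_simp
    _ ≤ _ := by gcongr
end
end
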